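/- arXiv:1105.3411 — 3 statements merged into one kernel-verified Lean document; each statement's English description precedes it below -/
import Mathlib

section
/- Let 3 ≤ k < t be integers. Every k-graph H on n vertices with t | n and δ_{k−1}(H) ≥ (1 − (t−1)/(t·C(t−1,k−1)))·n contains a collection of pairwise vertex-disjoint copies of K_t^k covering all but at most t²(t−1) vertices of H. -/
open Finset

/-- `A` is the vertex set of a copy of the hypergraph with vertex type `V` and edge set `EF`
inside the hypergraph on `Fin n` with edge set `E`. -/
def IsCopy {n : ℕ} {V : Type} [Fintype V] [DecidableEq V] (E : Finset (Finset (Fin n)))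
    (EF : Finset (Finset V)) (A : Finset (Fin n)) : Prop :=
  ∃ f : V ↪ Fin n, Finset.map f Finset.univ = A ∧ ∀ e ∈ EF, e.map f ∈ E

/-- The induced subhypergraph of `E` on `S` has an `F`-factor, where `F` has vertex type `V`
and edge set `EF`: there are pairwise vertex-disjoint copies of `F` covering exactly `S`. -/
def HasFactorOn {n : ℕ} {V : Type} [Fintype V] [DecidableEq V] (E : Finset (Finset (Fin n)))
    (EF : Finset (Finset V)) (S : Finset (Fin n)) : Prop :=
  ∃ P : Finset (Finset (Fin n)), (∀ A ∈ P, IsCopy E EF A) ∧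
    (P : Set (Finset (Fin n))).PairwiseDisjoint id ∧ P.biUnion id = S

/-- `x` is `(F, i, η)`-close to `y`. -/
def CloseTo {n : ℕ} {V : Type} [Fintype V] [DecidableEq V] (E : Finset (Finset (Fin n)))
    (EF : Finset (Finset V)) (i : ℕ) (η : ℝ) (x y : Fin n) : Prop :=
  η * (n : ℝ) ^ (i * Fintype.card V - 1) ≤
    (({S : Finset (Fin n) | S.card = i * Fintype.card V - 1 ∧ x ∉ S ∧ y ∉ S ∧
      HasFactorOn E EF (insert x S) ∧ HasFactorOn E EF (insert y S)}).ncard : ℝ)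

/-- `H` is `(F, i, η)`-closed. -/
def IsClosedGraph {n : ℕ} {V : Type} [Fintype V] [DecidableEq V] (E : Finset (Finset (Fin n)))
    (EF : Finset (Finset V)) (i : ℕ) (η : ℝ) : Prop :=
  ∀ x y : Fin n, x ≠ y → CloseTo E EF i η x y

/-- `Ñ_{F,i,η}(x)`: the set of vertices `(F, i, η)`-close to `x`. -/
def Ntilde {n : ℕ} {V : Type} [Fintype V] [DecidableEq V] (E : Finset (Finset (Fin n)))
    (EF : Finset (Finset V)) (i : ℕ) (η : ℝ) (x : Fin n) : Set (Fin n) :=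
  {y | CloseTo E EF i η x y}

/-- Degree of the set `T` in the `k`-graph with edge set `E`. -/
noncomputable def degOn {n : ℕ} (E : Finset (Finset (Fin n))) (k : ℕ) (T : Finset (Fin n)) : ℕ :=
  ({S : Finset (Fin n) | S.card = k - T.card ∧ Disjoint S T ∧ S ∪ T ∈ E}).ncard

/-- Edge set of the complete `k`-graph `K_t^k` on `Fin t`. -/
def cliqueEdges (t k : ℕ) : Finset (Finset (Fin t)) :=
  Finset.powersetCard k (Finset.univ : Finset (Fin t))

/-- Edge set of the complete `k`-partite `k`-graph `K_k^k(m)` with parts of size `m`. -/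
def multipartiteEdges (k m : ℕ) : Finset (Finset (Fin k × Fin m)) :=
  Finset.univ.filter (fun e : Finset (Fin k × Fin m) =>
    ∀ i : Fin k, (e.filter (fun v => v.1 = i)).card = 1)

/-- All `k`-subsets of `A` are edges. -/
def IsCliqueOn {n : ℕ} (E : Finset (Finset (Fin n))) (k : ℕ) (A : Finset (Fin n)) : Prop :=
  ∀ e ⊆ A, e.card = k → e ∈ E

/-- The vertex `v` extends `A` to a larger clique. -/
def Extends {n : ℕ} (E : Finset (Finset (Fin n))) (k : ℕ) (A : Finset (Fin n)) (v : Fin n) :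
    Prop :=
  v ∉ A ∧ IsCliqueOn E k (insert v A)

/-- The set of vertices of colour `i`. -/
def colorClass {n : ℕ} (χ : Fin n → Fin n) (i : Fin n) : Finset (Fin n) :=
  Finset.univ.filter (fun v => χ v = i)

/-- Every colour class is a clique on at most `t` vertices. -/
def IsCliqueColoring {n : ℕ} (E : Finset (Finset (Fin n))) (k t : ℕ) (χ : Fin n → Fin n) : Prop :=
  ∀ i, IsCliqueOn E k (colorClass χ i) ∧ (colorClass χ i).card ≤ t

/-- A rapidly flattening concave weight on clique sizes. -/
def cliqueWeight (t c : ℕ) : ℕ := ∑ j ∈ Finset.range c, (t + 1) ^ (t - 1 - j)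

/-- Total weight of a colouring. -/
def coloringWeight {n : ℕ} (t : ℕ) (χ : Fin n → Fin n) : ℕ :=
  ∑ i, cliqueWeight t (colorClass χ i).card

lemma mem_colorClass {n : ℕ} {χ : Fin n → Fin n} {i v : Fin n} :
    v ∈ colorClass χ i ↔ χ v = i := by
  simp [colorClass]

lemma sum_card_colorClass {n : ℕ} (χ : Fin n → Fin n) : ∑ i, (colorClass χ i).card = n := by
  have h := Finset.card_eq_sum_card_fiberwise (f := χ) (s := Finset.univ) (t := Finset.univ)
    (fun _ _ => Finset.mem_coe.2 (Finset.mem_univ _))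
  simpa [colorClass] using h.symm

/-- A bipartite relation with more than `|X| q` edges and `|Y| ≤ |X|` has a matching of size
`q + 1`. -/
lemma exists_matching_of_card_lt {α β : Type*} [DecidableEq α] [DecidableEq β] (X : Finset α)
    (R : α → β → Prop) [∀ a b, Decidable (R a b)] (q : ℕ) :
    ∀ Y : Finset β, Y.card ≤ X.card →
      X.card * q < ∑ y ∈ Y, (X.filter (fun x => R x y)).card →
      ∃ M ⊆ Y, M.card = q + 1 ∧ ∃ f : β → α, Set.InjOn f M ∧ ∀ y ∈ M, f y ∈ X ∧ R (f y) y := by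
  induction q with
  | zero =>
    intro Y _ h
    obtain ⟨y, hy, hpos⟩ : ∃ y ∈ Y, (X.filter (fun x => R x y)).card ≠ 0 := by
      by_contra! hcon
      rw [Finset.sum_eq_zero hcon] at h
      omega
    obtain ⟨x, hx⟩ := Finset.card_pos.1 (Nat.pos_of_ne_zero hpos)
    refine ⟨{y}, by simpa using hy, by simp, fun _ => x, by simp, ?_⟩
    simpa using hx
  | succ q ih =>
    intro Y hYX h
    obtain ⟨y, hy, hdeg⟩ : ∃ y ∈ Y, q + 1 < (X.filter (fun x => R x y)).card := by
      by_contra! hcon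
      have h1 := Finset.sum_le_card_nsmul Y _ _ hcon
      have h2 := Nat.mul_le_mul_right (q + 1) hYX
      simp only [smul_eq_mul] at h1
      omega
    have hsum := Finset.add_sum_erase Y (fun y => (X.filter (fun x => R x y)).card) hy
    have hle : (X.filter (fun x => R x y)).card ≤ X.card := Finset.card_filter_le _ _
    obtain ⟨M, hMY, hM, f, hf, hfR⟩ := ih (Y.erase y)
      ((Finset.card_le_card (Finset.erase_subset _ _)).trans hYX) (by
        rw [Nat.mul_succ] at h
        omega)
    obtain ⟨x, hx, hxM⟩ : ∃ x ∈ X.filter (fun x => R x y), x ∉ M.image f :=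
      Finset.exists_mem_notMem_of_card_lt_card
        ((Finset.card_image_le.trans hM.le).trans_lt hdeg)
    have hyM : y ∉ M := fun h => Finset.notMem_erase y Y (hMY h)
    have hne : ∀ z ∈ M, z ≠ y := fun z hz h => hyM (h ▸ hz)
    rw [Finset.mem_filter] at hx
    refine ⟨insert y M, ?_, by rw [Finset.card_insert_of_notMem hyM, hM],
      Function.update f y x, ?_, ?_⟩
    · exact Finset.insert_subset hy (hMY.trans (Finset.erase_subset _ _))
    · rw [Finset.coe_insert, Set.injOn_insert (by simpa using hyM)]
      refine ⟨fun a ha b hb hab => ?_, ?_⟩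
      · rw [Function.update_of_ne (hne a ha), Function.update_of_ne (hne b hb)] at hab
        exact hf ha hb hab
      · rintro ⟨z, hz, hzx⟩
        rw [Function.update_self, Function.update_of_ne (hne z hz)] at hzx
        exact hxM (Finset.mem_image.2 ⟨z, hz, hzx⟩)
    · intro z hz
      rcases Finset.mem_insert.1 hz with rfl | hz
      · simpa using hx
      · rw [Function.update_of_ne (hne z hz)]
        exact hfR z hz

lemma degOn_le_card_filter {n k : ℕ} (hk : 1 ≤ k) (E : Finset (Finset (Fin n)))
    (T : Finset (Fin n)) (hT : T.card = k - 1) :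
    degOn E k T ≤ (Finset.univ.filter (fun v => v ∉ T ∧ insert v T ∈ E)).card := by
  rw [degOn, ← Set.ncard_coe_finset (Finset.univ.filter _)]
  refine (Set.ncard_le_ncard (t := (fun v => ({v} : Finset (Fin n))) ''
    ↑(Finset.univ.filter (fun v => v ∉ T ∧ insert v T ∈ E))) ?_ (Set.toFinite _)).trans
    (Set.ncard_image_le (Set.toFinite _))
  rintro S ⟨hS, hST, hSE⟩
  obtain ⟨v, rfl⟩ := Finset.card_eq_one.1 (show S.card = 1 by omega)
  refine ⟨v, ?_, rfl⟩
  rw [Finset.disjoint_singleton_left] at hST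
  rw [Finset.singleton_union] at hSE
  simpa using ⟨hST, hSE⟩

lemma choose_mul_le {k s t : ℕ} (hk : 2 ≤ k) (hs : s < t) :
    s.choose (k - 1) * (t - 1) ≤ s * (t - 1).choose (k - 1) := by
  obtain ⟨j, rfl⟩ : ∃ j, k = j + 2 := ⟨k - 2, by omega⟩
  obtain ⟨t, rfl⟩ : ∃ r, t = r + 1 := ⟨t - 1, by omega⟩
  rcases s with _ | s
  · simp
  rcases t with _ | t
  · omega
  simp only [Nat.add_sub_cancel, show j + 2 - 1 = j + 1 by omega]
  have h1 := Nat.add_one_mul_choose_eq s j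
  have h2 := Nat.add_one_mul_choose_eq t j
  have h3 : s.choose j ≤ t.choose j := Nat.choose_le_choose j (by omega)
  refine Nat.le_of_mul_le_mul_right (c := j + 1) ?_ (by omega)
  calc (s + 1).choose (j + 1) * (t + 1) * (j + 1)
      = (s + 1) * (t + 1) * s.choose j := by rw [mul_right_comm, ← h1]; ring
    _ ≤ (s + 1) * (t + 1) * t.choose j := Nat.mul_le_mul_left _ h3
    _ = (s + 1) * (t + 1).choose (j + 1) * (j + 1) := by rw [mul_assoc, mul_assoc, h2]

open Classical in
/-- A clique on `s < t` vertices is extended by at least `(t - s) n / t` vertices. -/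
lemma card_extends_ge {k t n : ℕ} (hk : 3 ≤ k) (hn : t ∣ n)
    (E : Finset (Finset (Fin n)))
    (hdeg : ∀ T : Finset (Fin n), T.card = k - 1 →
      (1 - ((t : ℝ) - 1) / ((t : ℝ) * ((t - 1).choose (k - 1) : ℝ))) * n ≤
        (degOn E k T : ℝ))
    (A : Finset (Fin n)) (hA : IsCliqueOn E k A) (hs : A.card < t) :
    (t - A.card) * n ≤ t * (Finset.univ.filter (Extends E k A)).card := by
  set N := Finset.univ.filter (fun v => ¬ Extends E k A v)
  have hsplit : (Finset.univ.filter (Extends E k A)).card + N.card = n := by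
    have := Finset.card_filter_add_card_filter_not (s := (Finset.univ : Finset (Fin n)))
      (Extends E k A)
    simpa using this
  suffices hmain : t * N.card ≤ A.card * n by
    have h1 : t * n = t * (Finset.univ.filter (Extends E k A)).card + t * N.card := by
      rw [← mul_add, hsplit]
    rw [Nat.sub_mul]
    omega
  have hnt : t ≤ n ∨ n = 0 := by
    rcases Nat.eq_zero_or_pos n with h | h
    · exact Or.inr h
    · exact Or.inl (Nat.le_of_dvd h hn)
  rcases lt_or_ge A.card (k - 1) with hlt | hge
  · have hNA : N ⊆ A := by
      intro v hv
      by_contra hvA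
      refine (Finset.mem_filter.1 hv).2 ⟨hvA, fun e he hek => ?_⟩
      have := Finset.card_le_card he
      have := Finset.card_insert_le v A
      omega
    have hc := Finset.card_le_card hNA
    rcases hnt with h | h
    · calc t * N.card ≤ n * A.card := Nat.mul_le_mul h hc
        _ = A.card * n := mul_comm _ _
    · have : N.card = 0 := by omega
      simp [this]
  · set D := (t - 1).choose (k - 1)
    have hDpos : 0 < D := Nat.choose_pos (by omega)
    have hbad : ∀ T ∈ A.powersetCard (k - 1),
        t * D * (Finset.univ.filter (fun v => ¬ (v ∉ T ∧ insert v T ∈ E))).card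
          ≤ (t - 1) * n := by
      intro T hT
      have hTc := (Finset.mem_powersetCard.1 hT).2
      have h1 := hdeg T hTc
      have h2 := degOn_le_card_filter (by omega) E T hTc
      have h3 := Finset.card_filter_add_card_filter_not (s := (Finset.univ : Finset (Fin n)))
        (fun v => v ∉ T ∧ insert v T ∈ E)
      rw [Finset.card_univ, Fintype.card_fin] at h3
      set a := (Finset.univ.filter (fun v => v ∉ T ∧ insert v T ∈ E)).card
      set b := (Finset.univ.filter (fun v => ¬ (v ∉ T ∧ insert v T ∈ E))).card
      have h2' : (degOn E k T : ℝ) ≤ a := by exact_mod_cast h2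
      have h3' : (a : ℝ) + b = n := by exact_mod_cast h3
      have htD : (0 : ℝ) < t * D := by
        have : 0 < t * D := Nat.mul_pos (by omega) hDpos
        exact_mod_cast this
      have h4 : (b : ℝ) ≤ ((t : ℝ) - 1) / (t * D) * n := by linarith
      rw [div_mul_eq_mul_div, le_div_iff₀ htD] at h4
      have h5 : ((t - 1 : ℕ) : ℝ) = (t : ℝ) - 1 := by
        rw [Nat.cast_sub (by omega)]; simp
      rw [← h5] at h4
      have h6 : b * (t * D) ≤ (t - 1) * n := by exact_mod_cast h4
      linarith [mul_comm b (t * D)]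
    have hNsub : N ⊆ (A.powersetCard (k - 1)).biUnion
        (fun T => Finset.univ.filter (fun v => ¬ (v ∉ T ∧ insert v T ∈ E))) := by
      intro v hv
      by_contra hcon
      have hT : ∀ T ⊆ A, T.card = k - 1 → v ∉ T ∧ insert v T ∈ E := by
        intro T hTA hTc
        by_contra h
        exact hcon (Finset.mem_biUnion.2
          ⟨T, Finset.mem_powersetCard.2 ⟨hTA, hTc⟩, Finset.mem_filter.2 ⟨Finset.mem_univ v, h⟩⟩)
      refine (Finset.mem_filter.1 hv).2 ⟨fun hvA => ?_, fun e he hek => ?_⟩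
      · obtain ⟨T, hvT, hTA, hTc⟩ := Finset.exists_subsuperset_card_eq
          (Finset.singleton_subset_iff.2 hvA) (show ({v} : Finset (Fin n)).card ≤ k - 1 by
            rw [Finset.card_singleton]; omega) hge
        exact (hT T hTA hTc).1 (Finset.singleton_subset_iff.1 hvT)
      · by_cases hve : v ∈ e
        · have h := (hT (e.erase v) (Finset.subset_insert_iff.1 he)
            (by rw [Finset.card_erase_of_mem hve, hek])).2
          rwa [Finset.insert_erase hve] at h
        · exact hA e ((Finset.subset_insert_iff_of_notMem hve).1 he) hek
    have hcard : N.card ≤ ∑ T ∈ A.powersetCard (k - 1),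
        (Finset.univ.filter (fun v => ¬ (v ∉ T ∧ insert v T ∈ E))).card :=
      (Finset.card_le_card hNsub).trans Finset.card_biUnion_le
    have hsum : t * D * N.card ≤ A.card.choose (k - 1) * ((t - 1) * n) := by
      calc t * D * N.card ≤ _ := Nat.mul_le_mul_left _ hcard
        _ = _ := Finset.mul_sum _ _ _
        _ ≤ _ := Finset.sum_le_card_nsmul _ _ _ hbad
        _ = _ := by rw [Finset.card_powersetCard, smul_eq_mul]
    have hch := choose_mul_le (k := k) (by omega) hs
    refine le_of_mul_le_mul_left ?_ hDpos
    calc D * (t * N.card) = t * D * N.card := by ring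
      _ ≤ A.card.choose (k - 1) * ((t - 1) * n) := hsum
      _ = A.card.choose (k - 1) * (t - 1) * n := by ring
      _ ≤ A.card * D * n := Nat.mul_le_mul_right _ hch
      _ = D * (A.card * n) := by ring

lemma cliqueWeight_succ (t c : ℕ) :
    cliqueWeight t (c + 1) = cliqueWeight t c + (t + 1) ^ (t - 1 - c) :=
  Finset.sum_range_succ _ _

lemma cliqueWeight_mono (t : ℕ) : Monotone (cliqueWeight t) :=
  fun _ _ h => Finset.sum_le_sum_of_subset (Finset.range_mono h)

/-- Shrinking a clique of size `c` by `c - s + 1` vertices outweighs enlarging that many cliques of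
size `s` by one vertex. -/
lemma cliqueWeight_exchange {t s c : ℕ} (hs : 1 ≤ s) (hst : s < t) (hc : 1 ≤ c) (hct : c ≤ t) :
    cliqueWeight t (c - (c - s + 1)) + (c - s + 1) * (t + 1) ^ (t - 1 - s)
      < cliqueWeight t c := by
  obtain ⟨d, hd⟩ : ∃ d, c - (c - s + 1) = d := ⟨_, rfl⟩
  have h1 : cliqueWeight t (d + 1) ≤ cliqueWeight t c := cliqueWeight_mono t (by omega)
  rw [cliqueWeight_succ] at h1
  have h2 : (t + 1) ^ (t - 1 - s + 1) ≤ (t + 1) ^ (t - 1 - d) :=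
    Nat.pow_le_pow_right (by omega) (by omega)
  rw [pow_succ] at h2
  have h3 : (c - s + 1) * (t + 1) ^ (t - 1 - s) < (t + 1) ^ (t - 1 - s) * (t + 1) := by
    rw [mul_comm]
    exact Nat.mul_lt_mul_of_pos_left (by omega) (by positivity)
  rw [hd]
  omega

/-- Moving a matched subset `M` of the class of colour `c` into classes of size `s` that it
extends keeps a clique colouring, and its weight changes accordingly. -/
lemma coloringWeight_move {k t n s : ℕ} (hst : s < t) (E : Finset (Finset (Fin n)))
    (χ : Fin n → Fin n) (hχ : IsCliqueColoring E k t χ) (c : Fin n) (M : Finset (Fin n))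
    (hM : M ⊆ colorClass χ c) (f : Fin n → Fin n) (hf : Set.InjOn f M)
    (hfs : ∀ v ∈ M, (colorClass χ (f v)).card = s ∧ Extends E k (colorClass χ (f v)) v) :
    ∃ χ' : Fin n → Fin n, IsCliqueColoring E k t χ' ∧
      coloringWeight t χ' + cliqueWeight t (colorClass χ c).card =
        coloringWeight t χ + cliqueWeight t ((colorClass χ c).card - M.card) +
          M.card * (t + 1) ^ (t - 1 - s) := by
  have hfc : ∀ v ∈ M, f v ≠ c := fun v hv h => (hfs v hv).2.1 (h ▸ hM hv)
  have hMc : ∀ v ∈ M, χ v = c := fun v hv => mem_colorClass.1 (hM hv)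
  let χ' : Fin n → Fin n := fun v => if v ∈ M then f v else χ v
  have hχ'M : ∀ v ∈ M, χ' v = f v := fun v hv => if_pos hv
  have hχ'n : ∀ v ∉ M, χ' v = χ v := fun v hv => if_neg hv
  have hclass_c : colorClass χ' c = colorClass χ c \ M := by
    ext v
    rw [Finset.mem_sdiff, mem_colorClass, mem_colorClass]
    by_cases hv : v ∈ M
    · simp [hχ'M v hv, hfc v hv, hv]
    · simp [hχ'n v hv, hv]
  have hclass_f : ∀ v ∈ M, colorClass χ' (f v) = insert v (colorClass χ (f v)) := by
    intro v hv
    ext u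
    rw [Finset.mem_insert, mem_colorClass, mem_colorClass]
    by_cases hu : u ∈ M
    · rw [hχ'M u hu, hMc u hu]
      constructor
      · exact fun h => Or.inl (hf hu hv h)
      · rintro (rfl | h)
        · rfl
        · exact absurd h.symm (hfc v hv)
    · rw [hχ'n u hu]
      exact ⟨Or.inr, fun h => h.resolve_left (fun h => hu (h ▸ hv))⟩
  have hclass_o : ∀ i, i ≠ c → i ∉ M.image f → colorClass χ' i = colorClass χ i := by
    intro i hic hi
    ext u
    rw [mem_colorClass, mem_colorClass]
    by_cases hu : u ∈ M
    · rw [hχ'M u hu, hMc u hu]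
      exact ⟨fun h => absurd (Finset.mem_image.2 ⟨u, hu, h⟩) hi, fun h => absurd h.symm hic⟩
    · rw [hχ'n u hu]
  refine ⟨χ', fun i => ?_, ?_⟩
  · by_cases hic : i = c
    · subst hic
      rw [hclass_c]
      exact ⟨fun e he => (hχ i).1 e (he.trans Finset.sdiff_subset),
        (Finset.card_le_card Finset.sdiff_subset).trans (hχ i).2⟩
    · by_cases hi : i ∈ M.image f
      · obtain ⟨v, hv, rfl⟩ := Finset.mem_image.1 hi
        rw [hclass_f v hv]
        refine ⟨(hfs v hv).2.2, ?_⟩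
        rw [Finset.card_insert_of_notMem (hfs v hv).2.1, (hfs v hv).1]
        omega
      · rw [hclass_o i hic hi]
        exact hχ i
  · have hcn : c ∉ M.image f := by
      intro h
      obtain ⟨v, hv, hvc⟩ := Finset.mem_image.1 h
      exact hfc v hv hvc
    have hsplit : ∀ g : Fin n → ℕ, ∑ i, g i =
        g c + ∑ v ∈ M, g (f v) + ∑ i ∈ (insert c (M.image f))ᶜ, g i := by
      intro g
      rw [← Finset.sum_add_sum_compl (insert c (M.image f)) g, Finset.sum_insert hcn,
        Finset.sum_image hf]
    rw [coloringWeight, coloringWeight, hsplit, hsplit (fun i => cliqueWeight t _)]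
    have h1 : ∑ v ∈ M, cliqueWeight t (colorClass χ' (f v)).card =
        ∑ v ∈ M, cliqueWeight t (colorClass χ (f v)).card + M.card * (t + 1) ^ (t - 1 - s) := by
      rw [← smul_eq_mul, ← Finset.sum_const, ← Finset.sum_add_distrib]
      refine Finset.sum_congr rfl fun v hv => ?_
      rw [hclass_f v hv, Finset.card_insert_of_notMem (hfs v hv).2.1, (hfs v hv).1,
        cliqueWeight_succ]
    have h2 : ∑ i ∈ (insert c (M.image f))ᶜ, cliqueWeight t (colorClass χ' i).card =
        ∑ i ∈ (insert c (M.image f))ᶜ, cliqueWeight t (colorClass χ i).card := by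
      refine Finset.sum_congr rfl fun i hi => ?_
      rw [Finset.mem_compl, Finset.mem_insert, not_or] at hi
      rw [hclass_o i hi.1 hi.2]
    rw [h1, h2, hclass_c, Finset.card_sdiff_of_subset hM]
    ring

lemma exists_min_cliqueColoring {k t n : ℕ} (hk : 2 ≤ k) (ht : 1 ≤ t)
    (E : Finset (Finset (Fin n))) :
    ∃ χ : Fin n → Fin n, IsCliqueColoring E k t χ ∧
      ∀ χ', IsCliqueColoring E k t χ' → coloringWeight t χ ≤ coloringWeight t χ' := by
  have hid : IsCliqueColoring E k t id := by
    intro i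
    have hi : colorClass id i = {i} := by ext v; simp [mem_colorClass]
    rw [hi, Finset.card_singleton]
    refine ⟨fun e he hek => ?_, ht⟩
    have := Finset.card_le_card he
    rw [Finset.card_singleton] at this
    omega
  obtain ⟨χ, hχ, hmin⟩ := Set.exists_min_image {χ | IsCliqueColoring E k t χ} (coloringWeight t)
    (Set.toFinite _) ⟨id, hid⟩
  exact ⟨χ, hχ, hmin⟩

/-- In a clique colouring of minimum weight there are fewer than `t` classes of each size
strictly between `0` and `t`. -/
lemma card_colorClass_eq_lt {k t n s : ℕ} (hk : 3 ≤ k) (hn : t ∣ n)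
    (E : Finset (Finset (Fin n)))
    (hdeg : ∀ T : Finset (Fin n), T.card = k - 1 →
      (1 - ((t : ℝ) - 1) / ((t : ℝ) * ((t - 1).choose (k - 1) : ℝ))) * n ≤
        (degOn E k T : ℝ))
    (χ : Fin n → Fin n) (hχ : IsCliqueColoring E k t χ)
    (hmin : ∀ χ', IsCliqueColoring E k t χ' → coloringWeight t χ ≤ coloringWeight t χ')
    (hs : 1 ≤ s) (hst : s < t) :
    (Finset.univ.filter (fun i => (colorClass χ i).card = s)).card < t := by
  classical
  by_contra! hX
  set X := Finset.univ.filter (fun i => (colorClass χ i).card = s)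
  have hXs : ∀ i ∈ X, (colorClass χ i).card = s := fun i hi => (Finset.mem_filter.1 hi).2
  let R : Fin n → Fin n → Prop := fun i v => Extends E k (colorClass χ i) v
  have hclass : ∀ c, ∑ v ∈ colorClass χ c, (X.filter (fun i => R i v)).card ≤
      X.card * ((colorClass χ c).card - s) := by
    intro c
    by_contra! hlt
    obtain ⟨M, hMc, hM, f, hf, hfR⟩ := exists_matching_of_card_lt X R _ (colorClass χ c)
      ((hχ c).2.trans hX) hlt
    obtain ⟨χ', hχ', hw⟩ := coloringWeight_move hst E χ hχ c M hMc f hf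
      (fun v hv => ⟨hXs _ (hfR v hv).1, (hfR v hv).2⟩)
    have h1 := hmin χ' hχ'
    have hpos : 1 ≤ (colorClass χ c).card := by
      have := Finset.card_le_card hMc
      omega
    have h2 := cliqueWeight_exchange hs hst hpos (hχ c).2
    rw [hM] at hw
    omega
  have hdouble : ∑ c, ∑ v ∈ colorClass χ c, (X.filter (fun i => R i v)).card =
      ∑ i ∈ X, (Finset.univ.filter (R i)).card := by
    have h1 : ∑ c, ∑ v ∈ colorClass χ c, (X.filter (fun i => R i v)).card =
        ∑ v, (X.filter (fun i => R i v)).card :=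
      Finset.sum_fiberwise Finset.univ χ _
    rw [h1]
    exact (Finset.sum_card_bipartiteAbove_eq_sum_card_bipartiteBelow
      (s := X) (t := (Finset.univ : Finset (Fin n))) R).symm
  have hlow : X.card * ((t - s) * n) ≤ t * ∑ i ∈ X, (Finset.univ.filter (R i)).card := by
    rw [Finset.mul_sum, ← smul_eq_mul]
    refine Finset.card_nsmul_le_sum _ _ _ fun i hi => ?_
    have h := card_extends_ge hk hn E hdeg _ (hχ i).1 (by rw [hXs i hi]; exact hst)
    rwa [hXs i hi] at h
  have hup : ∑ i ∈ X, (Finset.univ.filter (R i)).card ≤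
      X.card * ∑ c, ((colorClass χ c).card - s) := by
    rw [← hdouble, Finset.mul_sum]
    exact Finset.sum_le_sum fun c _ => hclass c
  have hXpos : 0 < X.card := by omega
  have hcomb : (t - s) * n ≤ t * ∑ c, ((colorClass χ c).card - s) := by
    refine le_of_mul_le_mul_left ?_ hXpos
    calc X.card * ((t - s) * n) ≤ _ := hlow
      _ ≤ _ := Nat.mul_le_mul_left t hup
      _ = _ := by ring
  have hterm : ∀ c ≤ t, t * (c - s) ≤ (t - s) * c := by
    intro c hc
    rw [Nat.mul_sub, Nat.sub_mul]
    have := Nat.mul_le_mul_left s hc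
    rw [mul_comm s t] at this
    omega
  obtain ⟨i, hi⟩ := Finset.card_pos.1 hXpos
  have hstrict : ∑ c, t * ((colorClass χ c).card - s) < ∑ c, (t - s) * (colorClass χ c).card := by
    refine Finset.sum_lt_sum (fun c _ => hterm _ (hχ c).2) ⟨i, Finset.mem_univ i, ?_⟩
    rw [hXs i hi, Nat.sub_self, mul_zero]
    exact Nat.mul_pos (by omega) (by omega)
  rw [← Finset.mul_sum, ← Finset.mul_sum, sum_card_colorClass] at hstrict
  omega

lemma isCopy_of_isCliqueOn {n k t : ℕ} {E : Finset (Finset (Fin n))} {A : Finset (Fin n)}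
    (hA : IsCliqueOn E k A) (hAt : A.card = t) : IsCopy E (cliqueEdges t k) A := by
  refine ⟨(A.orderEmbOfFin hAt).toEmbedding, by simp, fun e he => hA _ ?_ ?_⟩
  · intro v hv
    obtain ⟨x, -, rfl⟩ := Finset.mem_map.1 hv
    exact A.orderEmbOfFin_mem hAt x
  · rw [Finset.card_map]
    exact (Finset.mem_powersetCard.1 he).2

/-- Almost perfect tiling: a `k`-graph with `t ∣ n` and minimum codegree at least
`(1 - (t-1)/(t·C(t-1,k-1))) n` contains vertex-disjoint copies of `K_t^k` covering
all but at most `t²(t-1)` vertices. -/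
theorem almost_perfect_Kt_tiling (k t n : ℕ) (hk : 3 ≤ k) (hkt : k < t) (hn : t ∣ n)
    (E : Finset (Finset (Fin n))) (hE : ∀ e ∈ E, e.card = k)
    (hdeg : ∀ T : Finset (Fin n), T.card = k - 1 →
      (1 - ((t : ℝ) - 1) / ((t : ℝ) * ((t - 1).choose (k - 1) : ℝ))) * n ≤
        (degOn E k T : ℝ)) :
    ∃ P : Finset (Finset (Fin n)),
      (∀ A ∈ P, IsCopy E (cliqueEdges t k) A) ∧
      (P : Set (Finset (Fin n))).PairwiseDisjoint id ∧
      n - (P.biUnion id).card ≤ t ^ 2 * (t - 1) := by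
  obtain ⟨χ, hχ, hmin⟩ := exists_min_cliqueColoring (k := k) (t := t) (by omega) (by omega) E
  let I : Finset (Fin n) := Finset.univ.filter (fun i => (colorClass χ i).card = t)
  have hdisj : ∀ i j, i ≠ j → Disjoint (colorClass χ i) (colorClass χ j) := by
    intro i j hij
    rw [Finset.disjoint_left]
    intro v hi hj
    exact hij ((mem_colorClass.1 hi).symm.trans (mem_colorClass.1 hj))
  refine ⟨I.image (colorClass χ), ?_, ?_, ?_⟩
  · intro A hA
    obtain ⟨i, hi, rfl⟩ := Finset.mem_image.1 hA
    exact isCopy_of_isCliqueOn (hχ i).1 (Finset.mem_filter.1 hi).2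
  · intro A hA B hB hAB
    obtain ⟨i, -, rfl⟩ := Finset.mem_image.1 (Finset.mem_coe.1 hA)
    obtain ⟨j, -, rfl⟩ := Finset.mem_image.1 (Finset.mem_coe.1 hB)
    exact hdisj i j fun h => hAB (h ▸ rfl)
  · have hcov : ((I.image (colorClass χ)).biUnion id).card = ∑ i ∈ I, (colorClass χ i).card := by
      rw [Finset.image_biUnion]
      exact Finset.card_biUnion fun i _ j _ hij => hdisj i j hij
    have hrest : ∑ i ∈ Iᶜ, (colorClass χ i).card ≤ t ^ 2 * (t - 1) := by
      have hmaps : ∀ i ∈ Iᶜ, (colorClass χ i).card ∈ Finset.range t := by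
        intro i hi
        rw [Finset.mem_compl, Finset.mem_filter, not_and] at hi
        exact Finset.mem_range.2 (lt_of_le_of_ne (hχ i).2 (hi (Finset.mem_univ i)))
      rw [← Finset.sum_fiberwise_of_maps_to hmaps]
      calc _ ≤ (Finset.range t).card • (t * (t - 1)) := Finset.sum_le_card_nsmul _ _ _ ?_
        _ = t ^ 2 * (t - 1) := by rw [Finset.card_range, smul_eq_mul]; ring
      intro s hs
      rw [Finset.mem_range] at hs
      rw [Finset.sum_congr rfl (g := fun _ => s) (fun i hi => (Finset.mem_filter.1 hi).2),
        Finset.sum_const, smul_eq_mul]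
      rcases Nat.eq_zero_or_pos s with rfl | hpos
      · simp
      · have h1 := card_colorClass_eq_lt hk hn E hdeg χ hχ hmin hpos hs
        refine Nat.mul_le_mul ((Finset.card_le_card ?_).trans h1.le) (by omega)
        exact Finset.filter_subset_filter _ (Finset.subset_univ _)
    have htot := Finset.sum_add_sum_compl I (fun i => (colorClass χ i).card)
    rw [sum_card_colorClass] at htot
    rw [hcov]
    omega
end

section
/- For every integer k ≥ 3 and every constant γ > 0 there exist a constant η > 0 and an integer n₀ such that every k-graph H on n ≥ n₀ vertices with δ_{k−1}(H) ≥ (1 − (k + ι_k)/(2k²) + γ)·n is (K_{k+1}^k, 1, η)-closed, where ι_k = 1 if k is odd and ι_k = 0 if k is even. -/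
open Finset

/-- `S` extends to a copy of `K_{k+1}^k` both by `x` and by `y`. -/
def IsCommonExtension {n : ℕ} (E : Finset (Finset (Fin n))) (k : ℕ) (x y : Fin n)
    (S : Finset (Fin n)) : Prop :=
  S.card = k ∧ x ∉ S ∧ y ∉ S ∧ S ∈ E ∧
    ∀ s ∈ S, insert x (S.erase s) ∈ E ∧ insert y (S.erase s) ∈ E

/-- `T` is a clique in the common link of `x` and `y`. -/
def IsLinkClique {n : ℕ} (E : Finset (Finset (Fin n))) (k : ℕ) (x y : Fin n)
    (T : Finset (Fin n)) : Prop :=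
  T.card = k ∧ x ∉ T ∧ y ∉ T ∧
    ∀ t ∈ T, insert x (T.erase t) ∈ E ∧ insert y (T.erase t) ∈ E

theorem degOn_add_card_filter {n k : ℕ} (hk : 1 ≤ k) (E : Finset (Finset (Fin n)))
    (hE : ∀ e ∈ E, e.card = k) (T : Finset (Fin n)) (hT : T.card = k - 1) :
    degOn E k T + #{w | insert w T ∉ E} = n := by
  have h : degOn E k T = #{w | insert w T ∈ E} := by
    unfold degOn
    have : {S : Finset (Fin n) | S.card = k - T.card ∧ Disjoint S T ∧ S ∪ T ∈ E} =
        (((univ.filter fun w => insert w T ∈ E).image fun w => ({w} : Finset (Fin n))) :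
          Set (Finset (Fin n))) := by
      ext S
      have h1 : k - T.card = 1 := by omega
      simp only [Set.mem_ofPred_eq, h1, coe_image, Set.mem_image, coe_filter, mem_univ, true_and]
      constructor
      · rintro ⟨hS, -, hSE⟩
        obtain ⟨w, rfl⟩ := card_eq_one.mp hS
        exact ⟨w, by rwa [insert_eq], rfl⟩
      · rintro ⟨w, hw, rfl⟩
        refine ⟨by simp, ?_, by rwa [← insert_eq]⟩
        rw [disjoint_singleton_left]
        intro hwT
        have := hE _ hw
        rw [insert_eq_of_mem hwT] at this
        omega
    rw [this, Set.ncard_coe_finset, card_image_of_injective _ singleton_injective]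
  rw [h]
  simpa using card_filter_add_card_filter_not (s := (univ : Finset (Fin n)))
    (fun w => insert w T ∈ E)

theorem hasFactorOn_of_erase_mem {n k : ℕ} (E : Finset (Finset (Fin n))) (A : Finset (Fin n))
    (hA : A.card = k + 1) (h : ∀ a ∈ A, A.erase a ∈ E) :
    HasFactorOn E (cliqueEdges (k + 1) k) A := by
  refine ⟨{A}, ?_, by simp, by simp⟩
  intro B hB
  obtain rfl := mem_singleton.mp hB
  refine ⟨(B.orderEmbOfFin hA).toEmbedding, ?_, ?_⟩
  · ext a
    simp only [mem_map, mem_univ, true_and]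
    exact Set.ext_iff.mp (B.range_orderEmbOfFin hA) a
  · intro e he
    obtain ⟨-, hec⟩ := mem_powersetCard.mp he
    set f := (B.orderEmbOfFin hA).toEmbedding
    have hsub : e.map f ⊆ B := by
      intro a ha
      obtain ⟨i, -, rfl⟩ := mem_map.mp ha
      exact B.orderEmbOfFin_mem hA i
    have hc : (B \ e.map f).card = 1 := by
      rw [card_sdiff_of_subset hsub, card_map, hA, hec]; omega
    obtain ⟨a, ha⟩ := card_eq_one.mp hc
    have haB : a ∈ B := (mem_sdiff.mp (ha ▸ mem_singleton_self a)).1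
    have : e.map f = B.erase a := by
      rw [← sdiff_singleton_eq_erase, ← ha, Finset.sdiff_sdiff_eq_self hsub]
    rw [this]
    exact h a haB

theorem IsCommonExtension.hasFactorOn {n k : ℕ} {E : Finset (Finset (Fin n))} {x y : Fin n}
    {S : Finset (Fin n)} (h : IsCommonExtension E k x y S) :
    HasFactorOn E (cliqueEdges (k + 1) k) (insert x S) ∧
      HasFactorOn E (cliqueEdges (k + 1) k) (insert y S) := by
  obtain ⟨hc, hx, hy, hS, hl⟩ := h
  have key : ∀ z, z ∉ S → (∀ s ∈ S, insert z (S.erase s) ∈ E) →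
      HasFactorOn E (cliqueEdges (k + 1) k) (insert z S) := by
    intro z hz hs
    refine hasFactorOn_of_erase_mem E _ (by rw [card_insert_of_notMem hz, hc]) ?_
    intro a ha
    rcases mem_insert.mp ha with rfl | ha
    · rwa [erase_insert hz]
    · rw [erase_insert_of_ne (by rintro rfl; exact hz ha)]
      exact hs a ha
  exact ⟨key x hx fun s hs => (hl s hs).1, key y hy fun s hs => (hl s hs).2⟩

theorem le_card_filter_forall_insert_mem {n : ℕ} (E 𝓕 : Finset (Finset (Fin n))) (B : ℝ)
    (h : ∀ F ∈ 𝓕, (#{w | insert w F ∉ E} : ℝ) ≤ B) :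
    n - 𝓕.card * B ≤ (#{w | ∀ F ∈ 𝓕, insert w F ∈ E} : ℝ) := by
  have h1 := card_filter_add_card_filter_not (s := (univ : Finset (Fin n)))
    (fun w => ∀ F ∈ 𝓕, insert w F ∈ E)
  have h2 : #{w | ¬ ∀ F ∈ 𝓕, insert w F ∈ E} ≤ ∑ F ∈ 𝓕, #{w | insert w F ∉ E} := by
    refine le_trans (card_le_card ?_) card_biUnion_le
    intro w
    simp
  have h3 : ((∑ F ∈ 𝓕, #{w | insert w F ∉ E} : ℕ) : ℝ) ≤ 𝓕.card * B := by
    push_cast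
    simpa using sum_le_card_nsmul 𝓕 _ B h
  have h4 : (#{w | ¬ ∀ F ∈ 𝓕, insert w F ∈ E} : ℝ) ≤ 𝓕.card * B :=
    le_trans (by exact_mod_cast h2) h3
  rw [card_univ, Fintype.card_fin] at h1
  have h5 : (#{w | ∀ F ∈ 𝓕, insert w F ∈ E} : ℝ) + (#{w | ¬ ∀ F ∈ 𝓕, insert w F ∈ E} : ℝ) = n := by
    exact_mod_cast h1
  linarith

theorem mul_le_card_filter_product {α β : Type*} [Fintype β] (s : Finset α)
    (q : α → β → Prop) [∀ a, DecidablePred (q a)] (c : ℝ)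
    (h : ∀ a ∈ s, c ≤ (#{b | q a b} : ℝ)) :
    s.card * c ≤ (#{p ∈ s ×ˢ (univ : Finset β) | q p.1 p.2} : ℝ) := by
  rw [card_filter, sum_product]
  push_cast
  have : ∀ a ∈ s, c ≤ ∑ b : β, (if q a b then (1 : ℝ) else 0) := by
    intro a ha
    simpa using h a ha
  simpa using card_nsmul_le_sum s _ c this

/-- If `insert w F` is an edge for few violations among the sets `F` obtained from a link clique
`T`, then replacing a vertex of `T` by `w` gives a common extension. -/
theorem IsLinkClique.exists_isCommonExtension {n k : ℕ} (hk : 3 ≤ k) {E : Finset (Finset (Fin n))}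
    (hE : ∀ e ∈ E, e.card = k) {x y : Fin n} {T : Finset (Fin n)}
    (hT : IsLinkClique E k x y T) (w : Fin n)
    (hw : 2 * (#{t ∈ T | insert w (T.erase t) ∉ E} +
      #{R ∈ T.powersetCard (k - 2) | insert w (insert x R) ∉ E} +
      #{R ∈ T.powersetCard (k - 2) | insert w (insert y R) ∉ E}) < k) :
    ∃ t ∈ T, IsCommonExtension E k x y (insert w (T.erase t)) := by
  obtain ⟨hTc, hx, hy, hl⟩ := hT
  have hcard : ∀ z : Fin n, #(({R ∈ T.powersetCard (k - 2) | insert w (insert z R) ∉ E}).biUnion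
      fun R => T \ R) ≤ #{R ∈ T.powersetCard (k - 2) | insert w (insert z R) ∉ E} * 2 := by
    intro z
    refine card_biUnion_le_card_mul _ _ _ ?_
    intro R hR
    obtain ⟨hR1, hR2⟩ := mem_powersetCard.mp (mem_filter.mp hR).1
    rw [card_sdiff_of_subset hR1]
    omega
  have hlt : #(({t ∈ T | insert w (T.erase t) ∉ E} ∪
      ({R ∈ T.powersetCard (k - 2) | insert w (insert x R) ∉ E}).biUnion fun R => T \ R) ∪
      ({R ∈ T.powersetCard (k - 2) | insert w (insert y R) ∉ E}).biUnion fun R => T \ R) <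
      T.card := by
    refine lt_of_le_of_lt (card_union_le _ _) ?_
    have := card_union_le {t ∈ T | insert w (T.erase t) ∉ E}
      (({R ∈ T.powersetCard (k - 2) | insert w (insert x R) ∉ E}).biUnion fun R => T \ R)
    have h1 := hcard x
    have h2 := hcard y
    omega
  obtain ⟨t, htT, ht⟩ := exists_mem_notMem_of_card_lt_card hlt
  simp only [mem_union, mem_filter, mem_biUnion, mem_sdiff, not_or, not_exists, not_and, not_not,
    mem_powersetCard, and_imp] at ht
  obtain ⟨⟨hA, hX⟩, hY⟩ := ht
  have hS : insert w (T.erase t) ∈ E := hA htT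
  have hwT : w ∉ T.erase t := by
    intro h
    have := hE _ hS
    rw [insert_eq_of_mem h, card_erase_of_mem htT] at this
    omega
  have hR : ∀ s ∈ T.erase t, ((T.erase t).erase s) ⊆ T ∧ ((T.erase t).erase s).card = k - 2 ∧
      t ∉ (T.erase t).erase s := by
    intro s hs
    refine ⟨(erase_subset _ _).trans (erase_subset _ _), ?_, by simp⟩
    rw [card_erase_of_mem hs, card_erase_of_mem htT]
    omega
  have hX' : ∀ s ∈ T.erase t, insert w (insert x ((T.erase t).erase s)) ∈ E := fun s hs => by
    obtain ⟨h1, h2, h3⟩ := hR s hs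
    by_contra h
    exact h3 (hX _ h1 h2 h htT)
  have hY' : ∀ s ∈ T.erase t, insert w (insert y ((T.erase t).erase s)) ∈ E := fun s hs => by
    obtain ⟨h1, h2, h3⟩ := hR s hs
    by_contra h
    exact h3 (hY _ h1 h2 h htT)
  have hne : (T.erase t).Nonempty := by
    rw [← card_pos, card_erase_of_mem htT]; omega
  obtain ⟨s₀, hs₀⟩ := hne
  have hwz : ∀ z, z ∉ T → insert w (insert z ((T.erase t).erase s₀)) ∈ E → z ≠ w := by
    rintro z hz h rfl
    have h1 := hE _ h
    obtain ⟨h2, h3, -⟩ := hR s₀ hs₀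
    rw [insert_idem, card_insert_of_notMem (fun h => hz (h2 h))] at h1
    omega
  refine ⟨t, htT, hE _ hS, ?_, ?_, hS, ?_⟩
  · simp only [mem_insert, mem_erase, not_or, not_and]
    exact ⟨hwz x hx (hX' s₀ hs₀), fun _ => hx⟩
  · simp only [mem_insert, mem_erase, not_or, not_and]
    exact ⟨hwz y hy (hY' s₀ hs₀), fun _ => hy⟩
  · intro s hs
    rcases mem_insert.mp hs with rfl | hs
    · rw [erase_insert hwT]
      exact hl t htT
    · rw [erase_insert_of_ne (by rintro rfl; exact hwT hs), insert_comm x, insert_comm y]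
      exact ⟨hX' s hs, hY' s hs⟩

theorem IsLinkClique.le_card_filter_isCommonExtension {n k : ℕ} (hk : 3 ≤ k)
    {E : Finset (Finset (Fin n))}
    (hE : ∀ e ∈ E, e.card = k) {x y : Fin n} {T : Finset (Fin n)}
    (hT : IsLinkClique E k x y T) (γ : ℝ) (hγ : 0 < γ)
    (hb : ∀ F : Finset (Fin n), F.card = k - 1 → (#{w | insert w F ∉ E} : ℝ) ≤
      (((k : ℝ) + (if Odd k then 1 else 0)) / (2 * (k : ℝ) ^ 2) - γ) * n) [DecidablePred
        fun w => ∃ t ∈ T, IsCommonExtension E k x y (insert w (T.erase t))] :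
    γ * n ≤ (#{w | ∃ t ∈ T, IsCommonExtension E k x y (insert w (T.erase t))} : ℝ) := by
  obtain ⟨hTc, hx, hy, hl⟩ := id hT
  set B : ℝ := (((k : ℝ) + (if Odd k then 1 else 0)) / (2 * (k : ℝ) ^ 2) - γ) * n with hB
  set ι : ℕ := if Odd k then 1 else 0 with hι
  set m : Fin n → ℕ := fun w => #{t ∈ T | insert w (T.erase t) ∉ E} +
      #{R ∈ T.powersetCard (k - 2) | insert w (insert x R) ∉ E} +
      #{R ∈ T.powersetCard (k - 2) | insert w (insert y R) ∉ E} with hm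
  have hsum : (∑ w, (m w : ℝ)) ≤ (k : ℝ) ^ 2 * B := by
    have hch : (#(T.powersetCard (k - 2)) : ℝ) = k * (k - 1) / 2 := by
      rw [card_powersetCard, hTc, Nat.choose_symm (by omega), Nat.cast_choose_two]
    have swap : ∀ (s : Finset (Finset (Fin n))), (∀ F ∈ s, F.card = k - 2) → ∀ z, (∀ F ∈ s, z ∉ F) →
        ∑ w, (#{R ∈ s | insert w (insert z R) ∉ E} : ℝ) ≤ s.card * B := by
      intro s hs z hz
      have : ∑ w, (#{R ∈ s | insert w (insert z R) ∉ E} : ℝ) =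
          ∑ R ∈ s, (#{w | insert w (insert z R) ∉ E} : ℝ) := by
        simp only [card_filter]
        push_cast
        exact sum_comm
      rw [this]
      refine le_trans (sum_le_card_nsmul s _ B ?_) (by simp)
      intro R hR
      apply hb
      rw [card_insert_of_notMem (hz R hR), hs R hR]
      omega
    have h1 : ∑ w, (#{t ∈ T | insert w (T.erase t) ∉ E} : ℝ) ≤ k * B := by
      have : ∑ w, (#{t ∈ T | insert w (T.erase t) ∉ E} : ℝ) =
          ∑ t ∈ T, (#{w | insert w (T.erase t) ∉ E} : ℝ) := by
        simp only [card_filter]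
        push_cast
        exact sum_comm
      rw [this]
      refine le_trans (sum_le_card_nsmul T _ B ?_) (by simp [hTc])
      intro t ht
      apply hb
      rw [card_erase_of_mem ht, hTc]
    have h2 := swap (T.powersetCard (k - 2)) (fun F hF => (mem_powersetCard.mp hF).2) x
      (fun F hF h => hx ((mem_powersetCard.mp hF).1 h))
    have h3 := swap (T.powersetCard (k - 2)) (fun F hF => (mem_powersetCard.mp hF).2) y
      (fun F hF h => hy ((mem_powersetCard.mp hF).1 h))
    rw [hch] at h2 h3
    have : ∑ w, (m w : ℝ) = ∑ w, (#{t ∈ T | insert w (T.erase t) ∉ E} : ℝ) +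
      ∑ w, (#{R ∈ T.powersetCard (k - 2) | insert w (insert x R) ∉ E} : ℝ) +
      ∑ w, (#{R ∈ T.powersetCard (k - 2) | insert w (insert y R) ∉ E} : ℝ) := by
      rw [← sum_add_distrib, ← sum_add_distrib]
      refine sum_congr rfl fun w _ => ?_
      simp [hm]
    rw [this]
    linarith
  have hlow : ((k + ι : ℕ) : ℝ) * (#{w | ¬ 2 * m w < k} : ℝ) ≤ 2 * ∑ w, (m w : ℝ) := by
    rw [mul_sum]
    refine le_trans ?_ (sum_le_sum_of_subset_of_nonneg
      (filter_subset (fun w => ¬ 2 * m w < k) univ) (fun _ _ _ => by positivity))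
    rw [mul_comm, ← nsmul_eq_mul]
    refine card_nsmul_le_sum _ _ _ fun w hw => ?_
    have hw' := (mem_filter.mp hw).2
    have : k + ι ≤ 2 * m w := by
      rw [hι]
      split_ifs with ho
      · obtain ⟨r, hr⟩ := ho
        omega
      · omega
    exact_mod_cast this
  have hpart := card_filter_add_card_filter_not (s := (univ : Finset (Fin n)))
    (fun w => 2 * m w < k)
  rw [card_univ, Fintype.card_fin] at hpart
  have hpart' : (#{w | 2 * m w < k} : ℝ) + (#{w | ¬ 2 * m w < k} : ℝ) = n := by
    exact_mod_cast hpart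
  have hmono : (#{w | 2 * m w < k} : ℝ) ≤
      (#{w | ∃ t ∈ T, IsCommonExtension E k x y (insert w (T.erase t))} : ℝ) := by
    exact_mod_cast card_le_card (monotone_filter_right univ fun w _ hw =>
      hT.exists_isCommonExtension hk hE w hw)
  refine le_trans ?_ hmono
  have hιR : ((k + ι : ℕ) : ℝ) = (k : ℝ) + (if Odd k then 1 else 0) := by
    rw [hι]; push_cast; rfl
  have hι1 : ι ≤ 1 := by rw [hι]; split_ifs <;> simp
  rw [← hιR] at hB
  have hkR : (3 : ℝ) ≤ k := by exact_mod_cast hk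
  have hkι : ((k + ι : ℕ) : ℝ) ≤ k + 1 := by exact_mod_cast (by omega)
  have hpos : (0 : ℝ) < ((k + ι : ℕ) : ℝ) := by exact_mod_cast (by omega)
  set K : ℝ := ((k + ι : ℕ) : ℝ) with hK
  have hn : (0 : ℝ) ≤ n := by positivity
  have hBe : 2 * ((k : ℝ) ^ 2 * B) = K * n - 2 * (k : ℝ) ^ 2 * γ * n := by
    rw [hB]; field_simp
  have h5 : K * (γ * n) ≤ 2 * (k : ℝ) ^ 2 * γ * n := by
    have : K ≤ 2 * (k : ℝ) ^ 2 := by nlinarith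
    calc K * (γ * n) ≤ 2 * (k : ℝ) ^ 2 * (γ * n) := by gcongr
      _ = _ := by ring
  have h6 : K * (γ * n) ≤ K * (#{w | 2 * m w < k} : ℝ) := by
    have : K * (#{w | 2 * m w < k} : ℝ) + K * (#{w | ¬ 2 * m w < k} : ℝ) = K * n := by
      rw [← mul_add, hpart']
    linarith
  exact le_of_mul_le_mul_left h6 hpos

theorem isLinkClique_insert_insert {n k : ℕ} (hk : 3 ≤ k) {E : Finset (Finset (Fin n))}
    (hE : ∀ e ∈ E, e.card = k) {x y : Fin n} {Q : Finset (Fin n)} (hQ : Q.card = k - 1)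
    (hxQ : x ∉ Q) (hyQ : y ∉ Q) (hQx : insert x Q ∈ E) (hQy : insert y Q ∈ E) {w : Fin n}
    (hw : ∀ u ∈ Q, insert w (insert x (Q.erase u)) ∈ E ∧ insert w (insert y (Q.erase u)) ∈ E) :
    IsLinkClique E k x y (insert w Q) := by
  have hsmall : ∀ z, z ∉ Q → ∀ u ∈ Q, insert w (insert z (Q.erase u)) ∈ E →
      w ∉ insert z (Q.erase u) := by
    intro z hz u hu h hmem
    have h1 := hE _ h
    rw [insert_eq_of_mem hmem, card_insert_of_notMem (fun h => hz (mem_of_mem_erase h)),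
      card_erase_of_mem hu] at h1
    omega
  obtain ⟨u, hu, v, hv, huv⟩ := one_lt_card.mp (show 1 < Q.card by omega)
  have hu1 := hsmall x hxQ u hu (hw u hu).1
  have hu2 := hsmall y hyQ u hu (hw u hu).2
  have hv1 := hsmall x hxQ v hv (hw v hv).1
  simp only [mem_insert, mem_erase, not_or, not_and] at hu1 hu2 hv1
  have hwQ : w ∉ Q := by
    by_cases h : w = u
    · exact hv1.2 (h ▸ huv)
    · exact hu1.2 h
  refine ⟨by rw [card_insert_of_notMem hwQ]; omega, ?_, ?_, ?_⟩
  · simp only [mem_insert, not_or]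
    exact ⟨fun h => hu1.1 h.symm, hxQ⟩
  · simp only [mem_insert, not_or]
    exact ⟨fun h => hu2.1 h.symm, hyQ⟩
  · intro t ht
    rcases mem_insert.mp ht with rfl | ht
    · rw [erase_insert hwQ]
      exact ⟨hQx, hQy⟩
    · rw [erase_insert_of_ne (by rintro rfl; exact hwQ ht), insert_comm x, insert_comm y]
      exact hw t ht

theorem choose_mul_le_card_isCommonExtension {n k : ℕ} (hk : 3 ≤ k) {E : Finset (Finset (Fin n))}
    (hE : ∀ e ∈ E, e.card = k) {x y : Fin n} (hxy : x ≠ y) (γ : ℝ) (hγ : 0 < γ) (hnk : k ≤ n)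
    (hb : ∀ F : Finset (Fin n), F.card = k - 1 → (#{w | insert w F ∉ E} : ℝ) ≤
      (((k : ℝ) + (if Odd k then 1 else 0)) / (2 * (k : ℝ) ^ 2) - γ) * n)
    [DecidablePred (IsCommonExtension E k x y)] :
    ((n - 2).choose (k - 2) : ℝ) * (γ * n) * (γ * n) * (γ * n) ≤
      (#{S | IsCommonExtension E k x y S} : ℝ) * n * (2 ^ (k + 1) * (k + 1) ^ 3) := by
  classical
  set B : ℝ := (((k : ℝ) + (if Odd k then 1 else 0)) / (2 * (k : ℝ) ^ 2) - γ) * n with hB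
  have hB0 : 0 ≤ B := by
    obtain ⟨F, -, hF⟩ := exists_subset_card_eq (s := (univ : Finset (Fin n))) (n := k - 1)
      (by simp; omega)
    exact le_trans (Nat.cast_nonneg _) (hb F hF)
  have hkR : (3 : ℝ) ≤ k := by exact_mod_cast hk
  have hn : (0 : ℝ) ≤ n := by positivity
  have hBle : 2 * ((k : ℝ) - 1) * B ≤ n - γ * n := by
    have h1 : (k : ℝ) + (if Odd k then 1 else 0) ≤ k + 1 := by split_ifs <;> linarith
    have h2 : ((k : ℝ) + (if Odd k then 1 else 0)) / (2 * (k : ℝ) ^ 2) ≤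
        (k + 1) / (2 * (k : ℝ) ^ 2) := by gcongr
    have h3 : 2 * ((k : ℝ) - 1) * ((k + 1) / (2 * (k : ℝ) ^ 2)) ≤ 1 := by
      rw [mul_div_assoc', div_le_one (by positivity)]
      nlinarith
    have h4 : 2 * ((k : ℝ) - 1) *
        (((k : ℝ) + (if Odd k then 1 else 0)) / (2 * (k : ℝ) ^ 2) - γ) ≤ 1 - γ := by
      have := mul_le_mul_of_nonneg_left h2 (show 0 ≤ 2 * ((k : ℝ) - 1) by linarith)
      nlinarith
    calc 2 * ((k : ℝ) - 1) * B = (2 * ((k : ℝ) - 1) *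
        (((k : ℝ) + (if Odd k then 1 else 0)) / (2 * (k : ℝ) ^ 2) - γ)) * n := by rw [hB]; ring
      _ ≤ (1 - γ) * n := by gcongr
      _ = _ := by ring
  have hext : ∀ 𝓕 : Finset (Finset (Fin n)), (∀ F ∈ 𝓕, F.card = k - 1) → 𝓕.card ≤ 2 * (k - 1) →
      γ * n ≤ (#{w | ∀ F ∈ 𝓕, insert w F ∈ E} : ℝ) := by
    intro 𝓕 h𝓕 hc
    refine le_trans ?_ (le_card_filter_forall_insert_mem E 𝓕 B fun F hF => hb F (h𝓕 F hF))
    have h1 : (𝓕.card : ℝ) ≤ 2 * ((k : ℝ) - 1) := by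
      have : ((2 * (k - 1) : ℕ) : ℝ) = 2 * ((k : ℝ) - 1) := by
        push_cast [Nat.cast_sub (show 1 ≤ k by omega)]; ring
      rw [← this]
      exact_mod_cast hc
    have := mul_le_mul_of_nonneg_right h1 hB0
    linarith
  set P := powersetCard (k - 2) ((univ : Finset (Fin n)) \ {x, y}) with hP
  have hPc : P.card = (n - 2).choose (k - 2) := by
    rw [hP, card_powersetCard, card_sdiff_of_subset (subset_univ _), card_pair hxy]
    simp
  have hPm : ∀ R ∈ P, R.card = k - 2 ∧ x ∉ R ∧ y ∉ R := by
    intro R hR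
    obtain ⟨h1, h2⟩ := mem_powersetCard.mp hR
    exact ⟨h2, fun h => by simpa using h1 h, fun h => by simpa using h1 h⟩
  set q₁ : Finset (Fin n) → Fin n → Prop := fun R v =>
    ∀ F ∈ ({insert x R, insert y R} : Finset (Finset (Fin n))), insert v F ∈ E
  set Ω₁ := {p ∈ P ×ˢ (univ : Finset (Fin n)) | q₁ p.1 p.2} with hΩ₁
  have hc₁ : P.card * (γ * n) ≤ (Ω₁.card : ℝ) := by
    refine mul_le_card_filter_product P q₁ _ fun R hR => ?_
    obtain ⟨h1, h2, h3⟩ := hPm R hR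
    refine hext _ ?_ (card_le_two.trans (by omega))
    intro F hF
    rcases mem_insert.mp hF with rfl | hF
    · rw [card_insert_of_notMem h2]; omega
    · rw [mem_singleton.mp hF, card_insert_of_notMem h3]; omega
  have hm₁ : ∀ p ∈ Ω₁, (insert p.2 p.1).card = k - 1 ∧ x ∉ insert p.2 p.1 ∧ y ∉ insert p.2 p.1 ∧
      insert x (insert p.2 p.1) ∈ E ∧ insert y (insert p.2 p.1) ∈ E := by
    rintro ⟨R, v⟩ hp
    obtain ⟨h0, hq⟩ := mem_filter.mp hp
    obtain ⟨h1, h2, h3⟩ := hPm R (mem_product.mp h0).1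
    have hqx : insert v (insert x R) ∈ E := hq _ (by simp)
    have hqy : insert v (insert y R) ∈ E := hq _ (by simp)
    have key : ∀ z, z ∉ R → insert v (insert z R) ∈ E → v ∉ insert z R := by
      intro z hz h hmem
      have := hE _ h
      rw [insert_eq_of_mem hmem, card_insert_of_notMem hz] at this
      omega
    have hx' := key x h2 hqx
    have hy' := key y h3 hqy
    simp only [mem_insert, not_or] at hx' hy' ⊢
    refine ⟨by rw [card_insert_of_notMem hx'.2]; omega, ⟨fun h => hx'.1 h.symm, h2⟩,
      ⟨fun h => hy'.1 h.symm, h3⟩, ?_, ?_⟩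
    · rwa [insert_comm]
    · rwa [insert_comm]
  set q₂ : Finset (Fin n) × Fin n → Fin n → Prop := fun p w =>
    ∀ F ∈ ((insert p.2 p.1).image fun u => insert x ((insert p.2 p.1).erase u)) ∪
      (insert p.2 p.1).image fun u => insert y ((insert p.2 p.1).erase u), insert w F ∈ E
  set Ω₂ := {p ∈ Ω₁ ×ˢ (univ : Finset (Fin n)) | q₂ p.1 p.2} with hΩ₂
  have hc₂ : Ω₁.card * (γ * n) ≤ (Ω₂.card : ℝ) := by
    refine mul_le_card_filter_product Ω₁ q₂ _ fun p hp => ?_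
    obtain ⟨h1, h2, h3, -, -⟩ := hm₁ p hp
    refine hext _ ?_ ?_
    · intro F hF
      rcases mem_union.mp hF with hF | hF
      · obtain ⟨u, hu, rfl⟩ := mem_image.mp hF
        rw [card_insert_of_notMem (fun h => h2 (mem_of_mem_erase h)), card_erase_of_mem hu]
        omega
      · obtain ⟨u, hu, rfl⟩ := mem_image.mp hF
        rw [card_insert_of_notMem (fun h => h3 (mem_of_mem_erase h)), card_erase_of_mem hu]
        omega
    · refine (card_union_le _ _).trans ?_
      have h5 := card_image_le (s := insert p.2 p.1)
        (f := fun u => insert x ((insert p.2 p.1).erase u))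
      have h6 := card_image_le (s := insert p.2 p.1)
        (f := fun u => insert y ((insert p.2 p.1).erase u))
      omega
  have hm₂ : ∀ p ∈ Ω₂, IsLinkClique E k x y (insert p.2 (insert p.1.2 p.1.1)) := by
    rintro ⟨p, w⟩ hp
    obtain ⟨h0, hq⟩ := mem_filter.mp hp
    obtain ⟨h1, h2, h3, h4, h5⟩ := hm₁ p (mem_product.mp h0).1
    refine isLinkClique_insert_insert hk hE h1 h2 h3 h4 h5 fun u hu => ⟨?_, ?_⟩
    · exact hq _ (mem_union_left _ (mem_image_of_mem _ hu))
    · exact hq _ (mem_union_right _ (mem_image_of_mem _ hu))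
  set q₃ : (Finset (Fin n) × Fin n) × Fin n → Fin n → Prop := fun p u =>
    ∃ t ∈ insert p.2 (insert p.1.2 p.1.1),
      IsCommonExtension E k x y (insert u ((insert p.2 (insert p.1.2 p.1.1)).erase t))
  set Ω₃ := {p ∈ Ω₂ ×ˢ (univ : Finset (Fin n)) | q₃ p.1 p.2} with hΩ₃
  have hc₃ : Ω₂.card * (γ * n) ≤ (Ω₃.card : ℝ) :=
    mul_le_card_filter_product Ω₂ q₃ _ fun p hp =>
      (hm₂ p hp).le_card_filter_isCommonExtension hk hE γ hγ hb
  set G : Finset (Finset (Fin n)) := {S | IsCommonExtension E k x y S}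
  have hup : Ω₃.card ≤ (G ×ˢ (univ : Finset (Fin n))).card * (2 ^ (k + 1) * (k + 1) ^ 3) := by
    refine le_trans (card_le_card ?_) (card_biUnion_le_card_mul (G ×ˢ (univ : Finset (Fin n)))
      (fun p => (((insert p.2 p.1).powerset ×ˢ insert p.2 p.1) ×ˢ insert p.2 p.1) ×ˢ
        insert p.2 p.1) _ ?_)
    · rintro ⟨⟨⟨R, v⟩, w⟩, u⟩ hp
      obtain ⟨-, t, ht, hS⟩ := mem_filter.mp hp
      refine mem_biUnion.mpr ⟨(insert u ((insert w (insert v R)).erase t), t), by simpa [G] using hS,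
        ?_⟩
      have : insert t (insert u ((insert w (insert v R)).erase t)) =
          insert u (insert w (insert v R)) := by
        rw [insert_comm, insert_erase ht]
      simp only [this, mem_product, mem_powerset]
      refine ⟨⟨⟨?_, by simp⟩, by simp⟩, by simp⟩
      exact ((subset_insert _ _).trans (subset_insert _ _)).trans (subset_insert _ _)
    · rintro ⟨S, t⟩ hp
      have hS : S.card = k := ((mem_filter.mp (mem_product.mp hp).1).2).1
      have hA : (insert t S).card ≤ k + 1 := (card_insert_le _ _).trans (by omega)
      simp only [card_product, card_powerset]
      calc 2 ^ (insert t S).card * (insert t S).card * (insert t S).card * (insert t S).card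
          = 2 ^ (insert t S).card * (insert t S).card ^ 3 := by ring
        _ ≤ _ := by gcongr; norm_num
  have hup' : (Ω₃.card : ℝ) ≤ G.card * n * (2 ^ (k + 1) * (k + 1) ^ 3) := by
    rw [card_product, card_univ, Fintype.card_fin] at hup
    exact_mod_cast hup
  rw [← hPc]
  have hγn : 0 ≤ γ * n := by positivity
  calc (P.card : ℝ) * (γ * n) * (γ * n) * (γ * n) ≤ Ω₁.card * (γ * n) * (γ * n) := by gcongr
    _ ≤ Ω₂.card * (γ * n) := by gcongr
    _ ≤ Ω₃.card := hc₃
    _ ≤ _ := hup'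

theorem half_pow_le_factorial_mul_choose {n k : ℕ} (hk : 3 ≤ k) (hn : 2 * k ≤ n) :
    ((n : ℝ) / 2) ^ (k - 2) ≤ (k - 2).factorial * ((n - 2).choose (k - 2) : ℝ) := by
  have h := Nat.pow_le_choose (α := ℝ) (k - 2) (n - 2)
  rw [div_le_iff₀ (by positivity)] at h
  refine le_trans ?_ (h.trans_eq (mul_comm _ _))
  have : (n : ℝ) / 2 ≤ ((n - 2 + 1 - (k - 2) : ℕ) : ℝ) := by
    rw [div_le_iff₀ (by norm_num)]
    exact_mod_cast (by omega)
  gcongr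

/-- A `k`-graph with minimum codegree at least `(1 - (k + ι_k)/(2k²) + γ) n` is
`(K_{k+1}^k, 1, η)`-closed. -/
theorem Kk_plus_one_closed (k : ℕ) (hk : 3 ≤ k) (γ : ℝ) (hγ : 0 < γ) :
    ∃ η : ℝ, 0 < η ∧ ∃ n₀ : ℕ, ∀ n : ℕ, n₀ ≤ n →
      ∀ E : Finset (Finset (Fin n)), (∀ e ∈ E, e.card = k) →
      (∀ T : Finset (Fin n), T.card = k - 1 →
        (1 - ((k : ℝ) + (if Odd k then 1 else 0)) / (2 * (k : ℝ) ^ 2) + γ) * n ≤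
          (degOn E k T : ℝ)) →
      IsClosedGraph E (cliqueEdges (k + 1) k) 1 η := by
  set M : ℝ := 2 ^ (k + 1) * ((k : ℝ) + 1) ^ 3 with hM
  refine ⟨γ ^ 3 / (2 ^ (k - 2) * (k - 2).factorial * M), by positivity, 2 * k, ?_⟩
  intro n hn E hE hdeg x y hxy
  classical
  have hb : ∀ F : Finset (Fin n), F.card = k - 1 → (#{w | insert w F ∉ E} : ℝ) ≤
      (((k : ℝ) + (if Odd k then 1 else 0)) / (2 * (k : ℝ) ^ 2) - γ) * n := by
    intro F hF
    have h1 := hdeg F hF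
    have h2 : (degOn E k F : ℝ) + (#{w | insert w F ∉ E} : ℝ) = n := by
      exact_mod_cast degOn_add_card_filter (by omega) E hE F hF
    linarith
  have hmain := choose_mul_le_card_isCommonExtension hk hE hxy γ hγ (by omega) hb
  have hch := half_pow_le_factorial_mul_choose hk hn
  have hsub : #{S | IsCommonExtension E k x y S} ≤
      ({S : Finset (Fin n) | S.card = k ∧ x ∉ S ∧ y ∉ S ∧
        HasFactorOn E (cliqueEdges (k + 1) k) (insert x S) ∧
        HasFactorOn E (cliqueEdges (k + 1) k) (insert y S)}).ncard := by
    rw [← Set.ncard_coe_finset]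
    refine Set.ncard_le_ncard ?_ (Set.toFinite _)
    intro S hS
    have hS' : IsCommonExtension E k x y S := by simpa using hS
    exact ⟨hS'.1, hS'.2.1, hS'.2.2.1, hS'.hasFactorOn⟩
  unfold CloseTo
  simp only [Fintype.card_fin, one_mul, Nat.add_sub_cancel]
  refine le_trans ?_ (Nat.cast_le.mpr hsub)
  have hn0 : (0 : ℝ) < n := by exact_mod_cast (by omega)
  have hM0 : 0 < M := by positivity
  rw [div_mul_eq_mul_div, div_le_iff₀ (by positivity)]
  set g : ℝ := (#{S | IsCommonExtension E k x y S} : ℝ)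
  set c : ℝ := ((n - 2).choose (k - 2) : ℝ)
  have hpow : (n : ℝ) ^ k = n ^ (k - 2) * n ^ 2 := by
    rw [← pow_add]; congr 1; omega
  rw [div_pow, div_le_iff₀ (by positivity)] at hch
  refine le_of_mul_le_mul_right ?_ hn0
  calc γ ^ 3 * (n : ℝ) ^ k * n = n ^ (k - 2) * (γ * n) ^ 3 := by rw [hpow]; ring
    _ ≤ ((k - 2).factorial * c * 2 ^ (k - 2)) * (γ * n) ^ 3 := by gcongr
    _ = 2 ^ (k - 2) * (k - 2).factorial * (c * (γ * n) * (γ * n) * (γ * n)) := by ring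
    _ ≤ 2 ^ (k - 2) * (k - 2).factorial * (g * n * M) := by gcongr
    _ = _ := by ring
end

section
/- For integers t > k ≥ 3 and every constant γ with 0 < γ < β(k,t), there exist a positive integer i, a constant η > 0 and an integer n₀ such that every k-graph H on n ≥ n₀ vertices with δ_{k−1}(H) ≥ (1 − β(k,t) + γ)·n is (K_t^k, i, η)-closed. -/
open Finset

/-- `β(k,t,l)` from the paper. -/
noncomputable def betaL (k t l : ℕ) : ℝ :=
  2 / ((t.choose (k - 1) : ℝ) + ((t - l - 1).choose (k - 1) : ℝ) + ((l + 1).choose (k - 1) : ℝ))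

/-- The defining conditions for `l₀(k,t)` when `k ≥ 4`. -/
def GoodL (k t l : ℕ) : Prop :=
  2 * (l + 1) ≤ t ∧
  betaL k t l ≤ 1 / (((t - 1).choose (k - 1) : ℝ) + (l.choose (k - 1) : ℝ)) ∧
  (0 < (2 * l + 1).choose (k - 1) →
    betaL k t l ≤ 1 / (2 * ((2 * l + 1).choose (k - 1) : ℝ)))

/-- `l₀(k,t)`: equal to `1` when `k = 3`, and the largest `l` satisfying `GoodL k t l`
when `k ≥ 4`. -/
noncomputable def l0 (k t : ℕ) : ℕ := if k = 3 then 1 else sSup {l | GoodL k t l}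

/-- `β(k,t) = β(k,t,l₀(k,t))`. -/
noncomputable def betaKT (k t : ℕ) : ℝ := betaL k t (l0 k t)

/-- `d(k,t) = 1 - C(t-1,k-1)·β(k,t)`. -/
noncomputable def dKT (k t : ℕ) : ℝ := 1 - ((t - 1).choose (k - 1) : ℝ) * betaKT k t


noncomputable section

open scoped Classical

/-- Double counting of pairs `F ⊆ U`. -/
lemma card_mul_le_card_mul_two_pow {α : Type*} [DecidableEq α] (𝓕 𝓤 : Finset (Finset α)) (m : ℕ) (N : ℝ)
    (hU : ∀ U ∈ 𝓤, #U = m) (hN : ∀ F ∈ 𝓕, N ≤ (#{U ∈ 𝓤 | F ⊆ U} : ℝ)) :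
    (#𝓕 : ℝ) * N ≤ #𝓤 * 2 ^ m := by
  have h := Finset.sum_card_bipartiteAbove_eq_sum_card_bipartiteBelow
    (s := 𝓕) (t := 𝓤) (fun F U => F ⊆ U)
  have h1 : (#𝓕 : ℝ) * N ≤ ∑ F ∈ 𝓕, (#(bipartiteAbove (fun F U => F ⊆ U) 𝓤 F) : ℝ) := by
    rw [← nsmul_eq_mul]
    exact Finset.card_nsmul_le_sum _ _ _ hN
  have h2 : ∑ U ∈ 𝓤, #(bipartiteBelow (fun F U => F ⊆ U) 𝓕 U) ≤ #𝓤 * 2 ^ m := by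
    rw [← smul_eq_mul]
    refine Finset.sum_le_card_nsmul _ _ _ fun U hUm => ?_
    rw [← hU U hUm, ← Finset.card_powerset]
    refine Finset.card_le_card fun F hF => ?_
    simpa using (Finset.mem_filter.1 hF).2
  rw [← h] at h2
  refine h1.trans ?_
  exact_mod_cast h2

lemma card_mul_le_of_extension {α : Type*} [DecidableEq α] (𝓕 𝓤 : Finset (Finset α)) (m : ℕ) (g : ℝ)
    (hU : ∀ U ∈ 𝓤, #U = m)
    (h : ∀ F ∈ 𝓕, ∃ X : Finset α, g ≤ #X ∧ ∀ v ∈ X, v ∉ F ∧ insert v F ∈ 𝓤) :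
    (#𝓕 : ℝ) * g ≤ #𝓤 * 2 ^ m := by
  refine card_mul_le_card_mul_two_pow 𝓕 𝓤 m g hU fun F hF => ?_
  obtain ⟨X, hX, hv⟩ := h F hF
  refine hX.trans ?_
  norm_cast
  refine Finset.card_le_card_of_injOn (fun v => insert v F) ?_ ?_
  · intro v hvX
    simpa using (hv v hvX).2
  · intro v hvX w hwX hvw
    exact (Finset.insert_inj (hv v hvX).1).1 hvw

/-- Greedy counting: extending sets one vertex at a time. -/
lemma greedy_count {α : Type*} [DecidableEq α] (𝓕 : ℕ → Finset (Finset α)) (hc : ∀ p, ∀ U ∈ 𝓕 p, #U = p)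
    (p t : ℕ) (g : ℝ) (hg : 0 ≤ g) (j : ℕ) (hj : p + j ≤ t)
    (h : ∀ q, p ≤ q → q < p + j → ∀ F ∈ 𝓕 q, ∃ X : Finset α, g ≤ #X ∧
      ∀ v ∈ X, v ∉ F ∧ insert v F ∈ 𝓕 (q + 1)) :
    (#(𝓕 p) : ℝ) * (g / 2 ^ t) ^ j ≤ #(𝓕 (p + j)) := by
  induction j with
  | zero => simp
  | succ j ih =>
    have ih' := ih (by omega) fun q h1 h2 => h q h1 (by omega)
    have h1 := card_mul_le_of_extension (𝓕 (p + j)) (𝓕 (p + j + 1)) (p + j + 1) g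
      (hc _) (h (p + j) (by omega) (by omega))
    have h2 : (2 : ℝ) ^ (p + j + 1) ≤ 2 ^ t := pow_le_pow_right₀ (by norm_num) (by omega)
    have h3 : (#(𝓕 (p + j)) : ℝ) * (g / 2 ^ t) ≤ #(𝓕 (p + j + 1)) := by
      rw [← mul_div_assoc, div_le_iff₀ (by positivity)]
      exact h1.trans (by gcongr)
    calc (#(𝓕 p) : ℝ) * (g / 2 ^ t) ^ (j + 1)
        = (#(𝓕 p) : ℝ) * (g / 2 ^ t) ^ j * (g / 2 ^ t) := by ring
      _ ≤ #(𝓕 (p + j)) * (g / 2 ^ t) := by gcongr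
      _ ≤ _ := h3

/-- Every `k`-subset of `K` is an edge. -/
def Clq {n : ℕ} (k : ℕ) (E : Finset (Finset (Fin n))) (K : Finset (Fin n)) : Prop :=
  ∀ e ⊆ K, #e = k → e ∈ E

/-- The vertices that do not extend `T` to an edge. -/
def missed {n : ℕ} (E : Finset (Finset (Fin n))) (T : Finset (Fin n)) : Finset (Fin n) :=
  {v | insert v T ∉ E}

/-- Every `(k-1)`-set is extended to an edge by all but at most `θ n` vertices. -/
def FewMissed {n : ℕ} (k : ℕ) (θ : ℝ) (E : Finset (Finset (Fin n))) : Prop :=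
  ∀ T : Finset (Fin n), #T = k - 1 → (#(missed E T) : ℝ) ≤ θ * n

section Cliques

variable {n k : ℕ} {E : Finset (Finset (Fin n))}

lemma Clq.mono {K L : Finset (Fin n)} (hK : Clq k E K) (h : L ⊆ K) : Clq k E L :=
  fun e he => hK e (he.trans h)

lemma clq_of_card_lt {K : Finset (Fin n)} (h : #K < k) : Clq k E K := by
  intro e he hc
  have := card_le_card he
  omega

/-- A vertex extends `K` except for `a` as soon as it misses only `(k-1)`-sets through `a`. -/
lemma Clq.exchange {K : Finset (Fin n)} (hK : Clq k E K) {v a : Fin n}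
    (h : ∀ T ⊆ K, #T = k - 1 → a ∉ T → insert v T ∈ E) :
    Clq k E (insert v (K.erase a)) := by
  intro e he hc
  by_cases hv : v ∈ e
  · have h2 : e.erase v ⊆ K.erase a := by
      intro x hx
      rw [mem_erase] at hx
      exact (mem_insert.1 (he hx.2)).resolve_left hx.1
    have := h (e.erase v) (h2.trans (erase_subset _ _)) (by rw [card_erase_of_mem hv, hc])
      (fun ha => by simpa using h2 ha)
    rwa [Finset.insert_erase hv] at this
  · refine hK e (fun x hx => ?_) hc
    rcases mem_insert.1 (he hx) with rfl | h'
    · exact absurd hx hv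
    · exact mem_of_mem_erase h'

lemma Clq.extend {K : Finset (Fin n)} (hK : Clq k E K) {v : Fin n}
    (h : ∀ T ∈ powersetCard (k - 1) K, insert v T ∈ E) :
    Clq k E (insert v K) := by
  intro e he hc
  by_cases hv : v ∈ e
  · have h2 : e.erase v ⊆ K := by
      intro x hx
      rw [mem_erase] at hx
      exact (mem_insert.1 (he hx.2)).resolve_left hx.1
    have := h (e.erase v) (mem_powersetCard.2 ⟨h2, by rw [card_erase_of_mem hv, hc]⟩)
    rwa [Finset.insert_erase hv] at this
  · refine hK e (fun x hx => ?_) hc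
    rcases mem_insert.1 (he hx) with rfl | h'
    · exact absurd hx hv
    · exact h'

/-- Many vertices outside `D` extend all the sets of `𝒯` simultaneously. -/
lemma FewMissed.exists_extension {θ : ℝ} (hE : FewMissed k θ E)
    (𝒯 : Finset (Finset (Fin n))) (h𝒯 : ∀ T ∈ 𝒯, #T = k - 1) (D : Finset (Fin n)) :
    ∃ X : Finset (Fin n), (1 - #𝒯 * θ) * n - #D ≤ #X ∧
      ∀ v ∈ X, v ∉ D ∧ ∀ T ∈ 𝒯, insert v T ∈ E := by
  refine ⟨univ \ (𝒯.biUnion (missed E) ∪ D), ?_, ?_⟩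
  · have h1 : (#(𝒯.biUnion (missed E)) : ℝ) ≤ #𝒯 * (θ * n) := by
      have h2 : (#(𝒯.biUnion (missed E)) : ℝ) ≤ ∑ T ∈ 𝒯, (#(missed E T) : ℝ) := by
        exact_mod_cast card_biUnion_le
      refine h2.trans ?_
      rw [← nsmul_eq_mul]
      exact sum_le_card_nsmul _ _ _ fun T hT => hE T (h𝒯 T hT)
    have h3 : n ≤ #(univ \ (𝒯.biUnion (missed E) ∪ D)) + (#(𝒯.biUnion (missed E)) + #D) := by
      have := card_le_card_sdiff_add_card (t := 𝒯.biUnion (missed E) ∪ D)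
        (s := (univ : Finset (Fin n)))
      rw [card_univ, Fintype.card_fin] at this
      have := card_union_le (𝒯.biUnion (missed E)) D
      omega
    have h4 : (n : ℝ) ≤ #(univ \ (𝒯.biUnion (missed E) ∪ D)) +
        (#(𝒯.biUnion (missed E)) + #D) := by exact_mod_cast h3
    linarith
  · intro v hv
    simp only [mem_sdiff, mem_univ, true_and, mem_union, mem_biUnion, not_or, not_exists,
      not_and, missed, mem_filter, not_not] at hv
    exact ⟨hv.2, hv.1⟩

end Cliques

/-- Convexity of binomial coefficients. -/
lemma choose_add_choose_le (m s q d : ℕ) (hsq : s ≤ q) :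
    (s + d).choose m + q.choose m ≤ (q + d).choose m + s.choose m := by
  induction d with
  | zero => simp [add_comm]
  | succ d ih =>
    cases m with
    | zero => simp
    | succ m =>
      have h : (s + d).choose m ≤ (q + d).choose m := Nat.choose_le_choose m (by omega)
      rw [← add_assoc, ← add_assoc, Nat.choose_succ_succ, Nat.choose_succ_succ]
      simp only [Nat.succ_eq_add_one] at *
      omega

/-- The `(t+1)`-sets containing two `t`-cliques whose difference crosses the cut `(A, Aᶜ)`. -/
def crossing {n : ℕ} (k t : ℕ) (E : Finset (Finset (Fin n))) (A : Finset (Fin n)) :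
    Finset (Finset (Fin n)) :=
  {Y | #Y = t + 1 ∧ ∃ a ∈ Y, a ∈ A ∧ ∃ b ∈ Y, b ∉ A ∧ Clq k E (Y.erase a) ∧ Clq k E (Y.erase b)}

section Weights

variable {n k : ℕ} {E : Finset (Finset (Fin n))}

lemma FewMissed.sum_le {θ : ℝ} (hE : FewMissed k θ E) (S : Finset (Fin n)) :
    (∑ v : Fin n, (#{T ∈ powersetCard (k - 1) S | v ∈ missed E T} : ℝ)) ≤
      (#S).choose (k - 1) * (θ * n) := by
  have h := Finset.sum_card_bipartiteAbove_eq_sum_card_bipartiteBelow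
    (s := powersetCard (k - 1) S) (t := (univ : Finset (Fin n))) (fun T v => v ∈ missed E T)
  have h2 : (∑ v : Fin n, (#{T ∈ powersetCard (k - 1) S | v ∈ missed E T} : ℝ)) =
      ∑ T ∈ powersetCard (k - 1) S, (#(missed E T) : ℝ) := by
    have h3 : ∀ T, #(bipartiteAbove (fun T v => v ∈ missed E T) univ T) = #(missed E T) := by
      intro T
      congr 1
      ext v
      simp [bipartiteAbove]
    simp only [h3, bipartiteBelow] at h
    exact_mod_cast h.symm
  rw [h2, ← card_powersetCard, ← nsmul_eq_mul]
  exact sum_le_card_nsmul _ _ _ fun T hT => hE T (mem_powersetCard.1 hT).2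

/-- If `v` misses few `(k-1)`-subsets of the mixed clique `K`, then some `a ∈ K ∩ A` and some
`b ∈ K \ A` may both be exchanged for `v`. -/
lemma Clq.exists_exchange {K A : Finset (Fin n)} (hK : Clq k E K) (hA : (K ∩ A).Nonempty)
    (hB : (K \ A).Nonempty) {v : Fin n}
    (hv : #{T ∈ powersetCard (k - 1) K | v ∈ missed E T} +
      #{T ∈ powersetCard (k - 1) (K ∩ A) | v ∈ missed E T} +
      #{T ∈ powersetCard (k - 1) (K \ A) | v ∈ missed E T} ≤ 1) :
    ∃ a ∈ K ∩ A, ∃ b ∈ K \ A, Clq k E (insert v (K.erase a)) ∧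
      Clq k E (insert v (K.erase b)) := by
  by_cases h0 : ∃ T ∈ powersetCard (k - 1) K, v ∈ missed E T
  · obtain ⟨T, hT, hvT⟩ := h0
    have hT' := mem_powersetCard.1 hT
    have hpos : 1 ≤ #{T ∈ powersetCard (k - 1) K | v ∈ missed E T} :=
      card_pos.2 ⟨T, mem_filter.2 ⟨hT, hvT⟩⟩
    have hA0 : ({T ∈ powersetCard (k - 1) (K ∩ A) | v ∈ missed E T} : Finset _) = ∅ :=
      card_eq_zero.1 (by omega)
    have hB0 : ({T ∈ powersetCard (k - 1) (K \ A) | v ∈ missed E T} : Finset _) = ∅ :=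
      card_eq_zero.1 (by omega)
    have huniq : ∀ T' ⊆ K, #T' = k - 1 → T' ≠ T → insert v T' ∈ E := by
      intro T' hT'K hc hne
      by_contra hcon
      have : T' = T := card_le_one.1 (show #{T ∈ powersetCard (k - 1) K | v ∈ missed E T} ≤ 1 by
        omega) T' (mem_filter.2 ⟨mem_powersetCard.2 ⟨hT'K, hc⟩, by simpa [missed] using hcon⟩) T
          (mem_filter.2 ⟨hT, hvT⟩)
      exact hne this
    have hnA : ¬ T ⊆ K ∩ A := fun h => by
      have : T ∈ ({T ∈ powersetCard (k - 1) (K ∩ A) | v ∈ missed E T} : Finset _) :=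
        mem_filter.2 ⟨mem_powersetCard.2 ⟨h, hT'.2⟩, hvT⟩
      rw [hA0] at this
      simp at this
    have hnB : ¬ T ⊆ K \ A := fun h => by
      have : T ∈ ({T ∈ powersetCard (k - 1) (K \ A) | v ∈ missed E T} : Finset _) :=
        mem_filter.2 ⟨mem_powersetCard.2 ⟨h, hT'.2⟩, hvT⟩
      rw [hB0] at this
      simp at this
    obtain ⟨b, hbT, hb⟩ := not_subset.1 hnA
    obtain ⟨a, haT, ha⟩ := not_subset.1 hnB
    have hbK := hT'.1 hbT
    have haK := hT'.1 haT
    refine ⟨a, by simp_all, b, by simp_all, ?_, ?_⟩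
    · exact hK.exchange fun T' h1 h2 h3 => huniq T' h1 h2 (fun h => h3 (h ▸ haT))
    · exact hK.exchange fun T' h1 h2 h3 => huniq T' h1 h2 (fun h => h3 (h ▸ hbT))
  · push Not at h0
    have hall : ∀ T ⊆ K, #T = k - 1 → insert v T ∈ E := fun T h1 h2 => by
      simpa [missed] using h0 T (mem_powersetCard.2 ⟨h1, h2⟩)
    obtain ⟨a, ha⟩ := hA
    obtain ⟨b, hb⟩ := hB
    exact ⟨a, ha, b, hb, hK.exchange fun T h1 h2 _ => hall T h1 h2,
      hK.exchange fun T h1 h2 _ => hall T h1 h2⟩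

/-- A clique that is sufficiently balanced with respect to the cut `(A, Aᶜ)` is contained in
many crossing sets. -/
lemma FewMissed.exists_crossing_extension {t l : ℕ} {β γ : ℝ} (hE : FewMissed k (β - γ) E)
    (hγ : 0 < γ) (hβγ : γ < β) (hl : 2 * (l + 1) ≤ t) (hkt : k ≤ t)
    (hβ : ((t.choose (k - 1) : ℝ) + ((t - l - 1).choose (k - 1) : ℝ) +
      ((l + 1).choose (k - 1) : ℝ)) * β = 2) (hn : t ≤ γ / 4 * n)
    {K A : Finset (Fin n)} (hKt : #K = t) (hK : Clq k E K) (hA : l + 1 ≤ #(K ∩ A))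
    (hB : l + 1 ≤ #(K \ A)) :
    ∃ X : Finset (Fin n), γ / 4 * n ≤ #X ∧ ∀ v ∈ X, v ∉ K ∧ insert v K ∈ crossing k t E A := by
  set m : Fin n → ℕ := fun v => #{T ∈ powersetCard (k - 1) K | v ∈ missed E T} +
      #{T ∈ powersetCard (k - 1) (K ∩ A) | v ∈ missed E T} +
      #{T ∈ powersetCard (k - 1) (K \ A) | v ∈ missed E T} with hm
  have hcard : #(K ∩ A) + #(K \ A) = t := by
    rw [← hKt]; exact card_inter_add_card_sdiff K A
  have hn0 : (0 : ℝ) ≤ n := Nat.cast_nonneg n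
  have hconv : (((#(K ∩ A)).choose (k - 1) : ℝ) + ((#(K \ A)).choose (k - 1) : ℝ)) ≤
      ((t - l - 1).choose (k - 1) : ℝ) + ((l + 1).choose (k - 1) : ℝ) := by
    have := choose_add_choose_le (k - 1) (l + 1) (#(K \ A)) (#(K ∩ A) - (l + 1)) hB
    rw [show l + 1 + (#(K ∩ A) - (l + 1)) = #(K ∩ A) by omega,
      show #(K \ A) + (#(K ∩ A) - (l + 1)) = t - l - 1 by omega] at this
    exact_mod_cast this
  have hW1 : (1 : ℝ) ≤ t.choose (k - 1) := by
    exact_mod_cast Nat.choose_pos (by omega)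
  have hsum : (∑ v : Fin n, (m v : ℝ)) ≤ (2 - γ) * n := by
    have h1 := hE.sum_le K
    have h2 := hE.sum_le (K ∩ A)
    have h3 := hE.sum_le (K \ A)
    have h4 : (∑ v : Fin n, (m v : ℝ)) =
        (∑ v : Fin n, (#{T ∈ powersetCard (k - 1) K | v ∈ missed E T} : ℝ)) +
        (∑ v : Fin n, (#{T ∈ powersetCard (k - 1) (K ∩ A) | v ∈ missed E T} : ℝ)) +
        (∑ v : Fin n, (#{T ∈ powersetCard (k - 1) (K \ A) | v ∈ missed E T} : ℝ)) := by
      rw [← sum_add_distrib, ← sum_add_distrib]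
      simp [hm]
    rw [hKt] at h1
    have h5 : (((#(K ∩ A)).choose (k - 1) : ℝ) + ((#(K \ A)).choose (k - 1) : ℝ)) *
        ((β - γ) * n) ≤ (((t - l - 1).choose (k - 1) : ℝ) + ((l + 1).choose (k - 1) : ℝ)) *
        ((β - γ) * n) :=
      mul_le_mul_of_nonneg_right hconv (mul_nonneg (by linarith) hn0)
    have h6 : (1 : ℝ) * γ ≤ ((t.choose (k - 1) : ℝ) + ((t - l - 1).choose (k - 1) : ℝ) +
      ((l + 1).choose (k - 1) : ℝ)) * γ := by
      apply mul_le_mul_of_nonneg_right _ hγ.le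
      have : (0 : ℝ) ≤ ((t - l - 1).choose (k - 1) : ℝ) := Nat.cast_nonneg _
      have : (0 : ℝ) ≤ ((l + 1).choose (k - 1) : ℝ) := Nat.cast_nonneg _
      linarith
    calc (∑ v : Fin n, (m v : ℝ)) ≤ ((t.choose (k - 1) : ℝ) +
          ((t - l - 1).choose (k - 1) : ℝ) + ((l + 1).choose (k - 1) : ℝ)) * ((β - γ) * n) := by
            linarith
      _ = (2 - ((t.choose (k - 1) : ℝ) + ((t - l - 1).choose (k - 1) : ℝ) +
            ((l + 1).choose (k - 1) : ℝ)) * γ) * n := by rw [← hβ]; ring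
      _ ≤ (2 - γ) * n := by apply mul_le_mul_of_nonneg_right _ hn0; linarith
  refine ⟨univ.filter fun v => v ∉ K ∧ m v ≤ 1, ?_, ?_⟩
  · have h1 : ∀ v : Fin n, (2 : ℝ) - (if v ∉ K ∧ m v ≤ 1 then 2 else 0) -
        (if v ∈ K then 2 else 0) ≤ m v := by
      intro v
      by_cases hvK : v ∈ K
      · simp [hvK]
      · by_cases hv : m v ≤ 1
        · simp [hvK, hv]
        · have : (2 : ℝ) ≤ m v := by exact_mod_cast (by omega : 2 ≤ m v)
          simpa [hvK, hv] using this
    have h2 := (sum_le_sum fun v (_ : v ∈ univ) => h1 v).trans hsum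
    simp only [sum_sub_distrib, sum_const, card_univ, Fintype.card_fin, nsmul_eq_mul,
      ← sum_filter] at h2
    rw [show ({v | v ∈ K} : Finset (Fin n)) = K by ext; simp, hKt] at h2
    nlinarith
  · intro v hv
    obtain ⟨hvK, hmv⟩ := (mem_filter.1 hv).2
    refine ⟨hvK, ?_⟩
    obtain ⟨a, ha, b, hb, hca, hcb⟩ := hK.exists_exchange
      (card_pos.1 (by omega)) (card_pos.1 (by omega)) hmv
    rw [mem_inter] at ha
    rw [mem_sdiff] at hb
    refine mem_filter.2 ⟨mem_univ _, by rw [card_insert_of_notMem hvK, hKt], a,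
      mem_insert_of_mem ha.1, ha.2, b, mem_insert_of_mem hb.1, hb.2, ?_, ?_⟩
    · rwa [erase_insert_of_ne (fun h : v = a => hvK (h ▸ ha.1))]
    · rwa [erase_insert_of_ne (fun h : v = b => hvK (h ▸ hb.1))]

end Weights

lemma card_mul_le_of_extension' {α : Type*} [DecidableEq α] (𝓕 𝓤 : Finset (Finset α)) {m t : ℕ} (hmt : m ≤ t)
    {g : ℝ} (hU : ∀ U ∈ 𝓤, #U = m)
    (h : ∀ F ∈ 𝓕, ∃ X : Finset α, g ≤ #X ∧ ∀ v ∈ X, v ∉ F ∧ insert v F ∈ 𝓤) :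
    (#𝓕 : ℝ) * (g / 2 ^ t) ≤ #𝓤 := by
  have h1 := card_mul_le_of_extension 𝓕 𝓤 m g hU h
  have h2 : (2 : ℝ) ^ m ≤ 2 ^ t := pow_le_pow_right₀ (by norm_num) hmt
  rw [← mul_div_assoc, div_le_iff₀ (by positivity)]
  exact h1.trans (by gcongr)

lemma card_of_mem_crossing {n k t : ℕ} {E : Finset (Finset (Fin n))} {A Y : Finset (Fin n)}
    (hY : Y ∈ crossing k t E A) : #Y = t + 1 := (mem_filter.1 hY).2.1

section Cuts

variable {n k t : ℕ} {E : Finset (Finset (Fin n))}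

/-- A clique `U` extends to a clique by many vertices outside any set `D` that is not too
large. -/
lemma FewMissed.exists_clique_extension {θ : ℝ} (hE : FewMissed k θ E) (U D : Finset (Fin n))
    (hU : Clq k E U) :
    ∃ X : Finset (Fin n), (1 - (#U).choose (k - 1) * θ) * n - (#U + #D) ≤ #X ∧
      ∀ v ∈ X, v ∉ U ∧ v ∉ D ∧ Clq k E (insert v U) := by
  obtain ⟨X, hX, h⟩ := hE.exists_extension (powersetCard (k - 1) U)
    (fun T hT => (mem_powersetCard.1 hT).2) (U ∪ D)
  refine ⟨X, ?_, fun v hv => ?_⟩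
  · rw [card_powersetCard] at hX
    have : (#(U ∪ D) : ℝ) ≤ #U + #D := by exact_mod_cast card_union_le U D
    linarith
  · obtain ⟨h1, h2⟩ := h v hv
    rw [mem_union, not_or] at h1
    exact ⟨h1.1, h1.2, hU.extend h2⟩

lemma one_sub_choose_mul_ge {β γ N M c : ℝ} (hβγ : γ < β) (hM : 1 ≤ M)
    (hNM : N ≤ M) (hc : M * β ≤ c) (hγ : 0 < γ) : 1 - c + γ ≤ 1 - N * (β - γ) := by
  have : N * (β - γ) ≤ M * (β - γ) := mul_le_mul_of_nonneg_right hNM (by linarith)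
  nlinarith

/-- A lower bound for the number of cliques with `t` vertices that meet `A`. -/
lemma FewMissed.card_cliques_meeting {β γ g : ℝ} (hE : FewMissed k (β - γ) E) (hk : 2 ≤ k)
    (hkt : k < t) (hγ : 0 < γ) (hβγ : γ < β) (hβ : ((t - 1).choose (k - 1) : ℝ) * β ≤ 1)
    (hg : 0 < g) (hgγ : g ≤ γ / 4) (hn : t ≤ g * n) (A : Finset (Fin n)) :
    (#A : ℝ) * (g * n / 2 ^ (t + 1)) ^ (t - 1) ≤
      #({U | #U = t ∧ Clq k E U ∧ (U ∩ A).Nonempty} : Finset (Finset (Fin n))) := by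
  have hn0 : (0 : ℝ) ≤ n := Nat.cast_nonneg n
  have hgn : g * n ≤ γ / 4 * n := mul_le_mul_of_nonneg_right hgγ hn0
  set 𝓕 : ℕ → Finset (Finset (Fin n)) :=
    fun p => univ.filter fun U => #U = p ∧ Clq k E U ∧ (U ∩ A).Nonempty with h𝓕
  have h0 : #A ≤ #(𝓕 1) := by
    refine card_le_card_of_injOn (fun a => {a}) ?_ (fun a _ b _ h => by simpa using h)
    intro a ha
    have : Clq k E {a} := clq_of_card_lt (by rw [card_singleton]; omega)
    simp [h𝓕, this, singleton_inter_of_mem (mem_coe.1 ha)]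
  have h := greedy_count 𝓕 (fun p U hU => (mem_filter.1 hU).2.1) 1 (t + 1) (g * n)
    (by positivity) (t - 1) (by omega) ?_
  · rw [show 1 + (t - 1) = t by omega] at h
    refine le_trans ?_ h
    gcongr
  · intro p _ hp U hU
    obtain ⟨hUp, hUc, hUA⟩ := (mem_filter.1 hU).2
    obtain ⟨X, hX, hv⟩ := hE.exists_clique_extension U ∅ hUc
    refine ⟨X, ?_, fun v hvX => ⟨(hv v hvX).1, mem_filter.2 ⟨mem_univ _, ?_, (hv v hvX).2.2,
      hUA.mono (inter_subset_inter_right (subset_insert _ _))⟩⟩⟩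
    · have h1 : ((#U).choose (k - 1) : ℝ) ≤ (t - 1).choose (k - 1) := by
        exact_mod_cast Nat.choose_le_choose _ (by omega)
      have h2 : (1 : ℝ) ≤ (t - 1).choose (k - 1) := by
        exact_mod_cast Nat.choose_pos (by omega)
      have h3 := one_sub_choose_mul_ge hβγ h2 h1 hβ hγ
      have h4 : (#U : ℝ) ≤ t := by exact_mod_cast (by omega : #U ≤ t)
      have h5 := mul_le_mul_of_nonneg_right h3 hn0
      simp only [card_empty, Nat.cast_zero] at hX
      nlinarith
    · rw [card_insert_of_notMem (hv v hvX).1, hUp]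

/-- In the main range of parameters every large cut is crossed by many pairs of cliques. -/
lemma FewMissed.card_crossing_ge {l : ℕ} {β γ g : ℝ} (hE : FewMissed k (β - γ) E) (hk : 2 ≤ k)
    (hkt : k < t) (hl : 2 * (l + 1) ≤ t) (hγ : 0 < γ) (hβγ : γ < β) (hγ2 : γ ≤ 1 / 2)
    (h1 : ((t - 1).choose (k - 1) + l.choose (k - 1) : ℝ) * β ≤ 1)
    (h2 : ((2 * l + 1).choose (k - 1) : ℝ) * β ≤ 1 / 2)
    (h3 : ((t.choose (k - 1) : ℝ) + ((t - l - 1).choose (k - 1) : ℝ) +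
      ((l + 1).choose (k - 1) : ℝ)) * β = 2)
    (hg : 0 < g) (hgγ : g ≤ γ / 4) (hn : t ≤ g * n) (A : Finset (Fin n))
    (hA : (#A : ℝ) ≤ n / 2) :
    (#A : ℝ) * (g * n / 2 ^ (t + 1)) ^ t ≤ #(crossing k t E A) ∨
      (g * n / 2 ^ (t + 1)) ^ (t + 1) ≤ #(crossing k t E A) := by
  have hn0 : (0 : ℝ) ≤ n := Nat.cast_nonneg n
  have hgn : g * n ≤ γ / 4 * n := mul_le_mul_of_nonneg_right hgγ hn0
  have hβ0 : 0 < β := hγ.trans hβγ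
  have hch : (1 : ℝ) ≤ (t - 1).choose (k - 1) := by
    exact_mod_cast Nat.choose_pos (by omega)
  have hch' : (0 : ℝ) ≤ l.choose (k - 1) := Nat.cast_nonneg _
  have hβ1 : ((t - 1).choose (k - 1) : ℝ) * β ≤ 1 := by nlinarith
  by_cases hQ : ∀ Q : Finset (Fin n), #Q = t - 1 → γ / 2 * n ≤
      #(univ.filter fun v => v ∉ A ∧ ∀ T ∈ powersetCard (k - 1) Q, insert v T ∈ E)
  · left
    have h0 := hE.card_cliques_meeting hk hkt hγ hβγ hβ1 hg hgγ hn A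
    have hs := card_mul_le_of_extension'
      ({U | #U = t ∧ Clq k E U ∧ (U ∩ A).Nonempty} : Finset (Finset (Fin n)))
      (crossing k t E A) (m := t + 1) le_rfl (g := g * n) (fun U => card_of_mem_crossing) ?_
    · rw [show t = t - 1 + 1 by omega, pow_succ, show t - 1 + 1 = t by omega, ← mul_assoc]
      exact (mul_le_mul_of_nonneg_right h0 (by positivity)).trans hs
    · intro K hK
      obtain ⟨hKt, hKc, a, ha⟩ := (mem_filter.1 hK).2
      rw [mem_inter] at ha
      have hb := hQ (K.erase a) (by rw [card_erase_of_mem ha.1, hKt])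
      set Y := univ.filter fun v => v ∉ A ∧
        ∀ T ∈ powersetCard (k - 1) (K.erase a), insert v T ∈ E
      refine ⟨Y \ K, ?_, fun b hb => ?_⟩
      · have : (#Y : ℝ) ≤ #(Y \ K) + #K := by exact_mod_cast card_le_card_sdiff_add_card
        rw [hKt] at this
        linarith
      · rw [mem_sdiff] at hb
        obtain ⟨hbA, hbT⟩ := (mem_filter.1 hb.1).2
        refine ⟨hb.2, mem_filter.2 ⟨mem_univ _, by rw [card_insert_of_notMem hb.2, hKt], a,
          mem_insert_of_mem ha.1, ha.2, b, mem_insert_self _ _, hbA, ?_, ?_⟩⟩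
        · rw [erase_insert_of_ne (fun h : b = a => hb.2 (h ▸ ha.1))]
          exact (hKc.mono (erase_subset _ _)).extend hbT
        · rwa [erase_insert hb.2]
  · right
    push Not at hQ
    obtain ⟨Q, hQc, hQ⟩ := hQ
    set 𝓕 : ℕ → Finset (Finset (Fin n)) := fun p => univ.filter fun U => #U = p ∧ Clq k E U ∧
      min p (l + 1) ≤ #(U ∩ A) ∧ min (p - (l + 1)) (l + 1) ≤ #(U \ A) with h𝓕
    have hmono : ∀ (U : Finset (Fin n)) (v : Fin n),
        #(U ∩ A) ≤ #(insert v U ∩ A) ∧ #(U \ A) ≤ #(insert v U \ A) := fun U v =>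
      ⟨card_le_card (inter_subset_inter_right (subset_insert _ _)),
        card_le_card (sdiff_subset_sdiff (subset_insert _ _) le_rfl)⟩
    have h0 : (1 : ℝ) ≤ #(𝓕 0) := by
      have : ∅ ∈ 𝓕 0 := by
        have : Clq k E ∅ := clq_of_card_lt (by rw [card_empty]; omega)
        simpa [h𝓕] using this
      exact_mod_cast card_pos.2 ⟨_, this⟩
    have h := greedy_count 𝓕 (fun p U hU => (mem_filter.1 hU).2.1) 0 (t + 1) (g * n)
      (by positivity) t (by omega) ?_
    · rw [zero_add] at h
      have hs := card_mul_le_of_extension' (𝓕 t) (crossing k t E A) (m := t + 1) le_rfl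
        (g := g * n) (fun U => card_of_mem_crossing) ?_
      · rw [pow_succ]
        refine le_trans (mul_le_mul_of_nonneg_right ?_ (by positivity)) hs
        refine le_trans ?_ h
        exact le_mul_of_one_le_left (by positivity) h0
      · intro K hK
        obtain ⟨hKt, hKc, hKA, hKB⟩ := (mem_filter.1 hK).2
        obtain ⟨X, hX, hv⟩ := hE.exists_crossing_extension hγ hβγ hl hkt.le h3
          (hn.trans hgn) hKt hKc (A := A) (by omega) (by omega)
        exact ⟨X, hgn.trans hX, hv⟩
    · intro p _ hp U hU
      obtain ⟨hUp, hUc, hUA, hUB⟩ := (mem_filter.1 hU).2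
      have hUt : (#U : ℝ) ≤ t := by exact_mod_cast (by omega : #U ≤ t)
      rcases lt_or_ge p (l + 1) with hpl | hpl
      · obtain ⟨X, hX, hv⟩ := hE.exists_extension
          (powersetCard (k - 1) Q ∪ powersetCard (k - 1) U)
          (fun T hT => by
            rcases mem_union.1 hT with h | h <;> exact (mem_powersetCard.1 h).2) U
        refine ⟨X.filter (· ∈ A), ?_, fun v hvX => ?_⟩
        · have hc : (#(powersetCard (k - 1) Q ∪ powersetCard (k - 1) U) : ℝ) ≤
              (t - 1).choose (k - 1) + l.choose (k - 1) := by
            have := card_union_le (powersetCard (k - 1) Q) (powersetCard (k - 1) U)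
            rw [card_powersetCard, card_powersetCard, hQc] at this
            have h5 : (#U).choose (k - 1) ≤ l.choose (k - 1) :=
              Nat.choose_le_choose _ (by omega)
            exact_mod_cast this.trans (by omega)
          have h6 := mul_le_mul_of_nonneg_right
            (one_sub_choose_mul_ge hβγ (by linarith) hc h1 hγ) hn0
          have h7 : #X ≤ #(X.filter (· ∈ A)) + #(univ.filter fun v => v ∉ A ∧
              ∀ T ∈ powersetCard (k - 1) Q, insert v T ∈ E) := by
            rw [← card_filter_add_card_filter_not (s := X) (· ∈ A)]
            refine Nat.add_le_add_left (card_le_card fun v hvX => ?_) _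
            rw [mem_filter] at hvX
            exact mem_filter.2 ⟨mem_univ _, hvX.2, fun T hT => (hv v hvX.1).2 T
              (mem_union_left _ hT)⟩
          have h8 : (#X : ℝ) ≤ #(X.filter (· ∈ A)) + #(univ.filter fun v => v ∉ A ∧
              ∀ T ∈ powersetCard (k - 1) Q, insert v T ∈ E) := by exact_mod_cast h7
          linarith
        · rw [mem_filter] at hvX
          obtain ⟨hvU, hvT⟩ := hv v hvX.1
          refine ⟨hvU, mem_filter.2 ⟨mem_univ _, by rw [card_insert_of_notMem hvU, hUp],
            hUc.extend fun T hT => hvT T (mem_union_right _ hT), ?_, by omega⟩⟩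
          rw [insert_inter_of_mem hvX.2,
            card_insert_of_notMem fun h => hvU (mem_inter.1 h).1]
          omega
      · rcases lt_or_ge p (2 * (l + 1)) with hpl' | hpl'
        · obtain ⟨X, hX, hv⟩ := hE.exists_clique_extension U A hUc
          refine ⟨X, ?_, fun v hvX => ?_⟩
          · have h5 : ((#U).choose (k - 1) : ℝ) ≤ (2 * l + 1).choose (k - 1) := by
              exact_mod_cast Nat.choose_le_choose _ (by omega)
            have h6 : 1 / 2 + γ ≤ 1 - (#U).choose (k - 1) * (β - γ) := by
              rcases Nat.eq_zero_or_pos ((2 * l + 1).choose (k - 1)) with h7 | h7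
              · rw [h7, Nat.cast_zero] at h5
                have : ((#U).choose (k - 1) : ℝ) = 0 := le_antisymm h5 (Nat.cast_nonneg _)
                rw [this]
                linarith
              · have := one_sub_choose_mul_ge hβγ (by exact_mod_cast h7) h5 h2 hγ
                linarith
            have h7 := mul_le_mul_of_nonneg_right h6 hn0
            nlinarith
          · obtain ⟨hvU, hvA, hvc⟩ := hv v hvX
            refine ⟨hvU, mem_filter.2 ⟨mem_univ _, by rw [card_insert_of_notMem hvU, hUp],
              hvc, ?_, ?_⟩⟩
            · have := (hmono U v).1
              omega
            · rw [insert_sdiff_of_notMem _ hvA,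
                card_insert_of_notMem fun h => hvU (mem_sdiff.1 h).1]
              omega
        · obtain ⟨X, hX, hv⟩ := hE.exists_clique_extension U ∅ hUc
          refine ⟨X, ?_, fun v hvX => ?_⟩
          · have h5 : ((#U).choose (k - 1) : ℝ) ≤ (t - 1).choose (k - 1) := by
              exact_mod_cast Nat.choose_le_choose _ (by omega)
            have h7 := mul_le_mul_of_nonneg_right
              (one_sub_choose_mul_ge hβγ hch h5 hβ1 hγ) hn0
            simp only [card_empty, Nat.cast_zero] at hX
            nlinarith
          · obtain ⟨hvU, -, hvc⟩ := hv v hvX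
            have := hmono U v
            exact ⟨hvU, mem_filter.2 ⟨mem_univ _, by rw [card_insert_of_notMem hvU, hUp],
              hvc, by omega, by omega⟩⟩

end Cuts

section FourVertices

variable {n : ℕ} {E : Finset (Finset (Fin n))}

/-- A `4`-clique with three vertices in `A` extends in many ways to a set that is either crossing
or contains a `4`-clique with two vertices in `A`. -/
lemma FewMissed.exists_extension_three_one {γ g : ℝ} (hE : FewMissed 3 (1 / 4 - γ) E)
    (hgγ : g ≤ γ / 4) (hn : 4 ≤ g * n) {A K : Finset (Fin n)}
    (hA : (#A : ℝ) ≤ n / 2) (hK4 : #K = 4) (hK : Clq 3 E K) (hKA : #(K ∩ A) = 3) :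
    ∃ X : Finset (Fin n), g * n ≤ #X ∧ ∀ v ∈ X, v ∉ K ∧ (insert v K ∈ crossing 3 4 E A ∨
      ∃ M ⊆ insert v K, #M = 4 ∧ Clq 3 E M ∧ #(M ∩ A) = 2) := by
  have hn0 : (0 : ℝ) ≤ n := Nat.cast_nonneg n
  have hgn : g * n ≤ γ / 4 * n := mul_le_mul_of_nonneg_right hgγ hn0
  have hcard : #(K ∩ A) + #(K \ A) = 4 := by
    rw [← hK4]; exact card_inter_add_card_sdiff K A
  obtain ⟨y, hy⟩ := card_eq_one.1 (show #(K \ A) = 1 by omega)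
  have hyKA : y ∈ K \ A := by rw [hy]; exact mem_singleton_self y
  have hyK := (mem_sdiff.1 hyKA).1
  have hyA := (mem_sdiff.1 hyKA).2
  have hKy : K.erase y = K ∩ A := by
    ext x
    have : x ∈ K \ A ↔ x = y := by rw [hy, mem_singleton]
    rw [mem_sdiff] at this
    rw [mem_erase, mem_inter]
    tauto
  set m : Fin n → ℕ := fun v => #{T ∈ powersetCard (3 - 1) K | v ∈ missed E T} with hm
  set P : Fin n → Prop := fun v => (v ∈ A ∧ Clq 3 E (insert v (K.erase y))) ∨
    (v ∉ A ∧ ∃ c ∈ K ∩ A, Clq 3 E (insert v (K.erase c))) with hP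
  have hsum : (∑ v : Fin n, (m v : ℝ)) ≤ 6 * ((1 / 4 - γ) * n) := by
    have h1 := hE.sum_le K
    rw [hK4] at h1
    have h2 : Nat.choose 4 (3 - 1) = 6 := rfl
    rw [h2] at h1
    exact_mod_cast h1
  have hmA : ∀ v, v ∈ A → ¬ P v → 1 ≤ m v := by
    intro v hv hPv
    by_contra hcon
    have h0 : ({T ∈ powersetCard (3 - 1) K | v ∈ missed E T} : Finset _) = ∅ :=
      card_eq_zero.1 (by simp only [hm] at hcon; omega)
    refine hPv (Or.inl ⟨hv, hK.exchange fun T h1 h2 _ => ?_⟩)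
    by_contra h3
    have : T ∈ ({T ∈ powersetCard (3 - 1) K | v ∈ missed E T} : Finset _) :=
      mem_filter.2 ⟨mem_powersetCard.2 ⟨h1, h2⟩, by simpa [missed] using h3⟩
    rw [h0] at this
    simp at this
  have hmB : ∀ v, v ∉ A → ¬ P v → 2 ≤ m v := by
    intro v hv hPv
    by_contra hcon
    have hle : #{T ∈ powersetCard (3 - 1) K | v ∈ missed E T} ≤ 1 := by
      simp only [hm] at hcon; omega
    refine hPv (Or.inr ⟨hv, ?_⟩)
    by_cases h0 : ∃ T ∈ powersetCard (3 - 1) K, v ∈ missed E T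
    · obtain ⟨T, hT, hvT⟩ := h0
      obtain ⟨hTK, hTc⟩ := mem_powersetCard.1 hT
      have : ¬ T ⊆ K \ A := fun h => by
        have := card_le_card h
        omega
      obtain ⟨c, hcT, hc⟩ := not_subset.1 this
      have hcK := hTK hcT
      refine ⟨c, mem_inter.2 ⟨hcK, by_contra fun h => hc (mem_sdiff.2 ⟨hcK, h⟩)⟩, hK.exchange fun T' h1 h2 h3 => ?_⟩
      by_contra h4
      have : T' = T := card_le_one.1 hle T' (mem_filter.2 ⟨mem_powersetCard.2 ⟨h1, h2⟩,
        by simpa [missed] using h4⟩) T (mem_filter.2 ⟨hT, hvT⟩)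
      exact h3 (this ▸ hcT)
    · push Not at h0
      obtain ⟨c, hc⟩ := card_pos.1 (show 0 < #(K ∩ A) by omega)
      exact ⟨c, hc, hK.exchange fun T h1 h2 _ => by
        simpa [missed] using h0 T (mem_powersetCard.2 ⟨h1, h2⟩)⟩
  refine ⟨univ.filter fun v => v ∉ K ∧ P v, ?_, ?_⟩
  · have h1 : ∀ v : Fin n, (2 : ℝ) - (if v ∈ A then 1 else 0) -
        (if v ∉ K ∧ P v then 2 else 0) - (if v ∈ K then 2 else 0) ≤ m v := by
      intro v
      have hmv : (0 : ℝ) ≤ m v := Nat.cast_nonneg _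
      by_cases hvK : v ∈ K
      · by_cases hvA : v ∈ A
        · simp [hvK, hvA]; linarith
        · simp [hvK, hvA]
      · by_cases hvP : P v
        · by_cases hvA : v ∈ A
          · simp [hvK, hvA, hvP]; linarith
          · simp [hvK, hvA, hvP]
        · by_cases hvA : v ∈ A
          · have : (1 : ℝ) ≤ m v := by exact_mod_cast hmA v hvA hvP
            simp [hvK, hvA, hvP]; linarith
          · have : (2 : ℝ) ≤ m v := by exact_mod_cast hmB v hvA hvP
            simpa [hvK, hvA, hvP] using this
    have h2 := (sum_le_sum fun v (_ : v ∈ univ) => h1 v).trans hsum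
    have h3 : ∑ v : Fin n, (if v ∉ K ∧ P v then (2 : ℝ) else 0) =
        #(univ.filter fun v => v ∉ K ∧ P v) * 2 := by
      rw [← sum_filter, sum_const, nsmul_eq_mul]
    simp only [sum_sub_distrib, h3, sum_const, card_univ, Fintype.card_fin, nsmul_eq_mul,
      ← sum_filter] at h2
    rw [show ({v | v ∈ K} : Finset (Fin n)) = K by ext; simp, hK4,
      show ({v | v ∈ A} : Finset (Fin n)) = A by ext; simp] at h2
    push_cast at h2
    linarith
  · intro v hv
    obtain ⟨hvK, hPv⟩ := (mem_filter.1 hv).2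
    refine ⟨hvK, ?_⟩
    rcases hPv with ⟨hvA, hc⟩ | ⟨hvA, c, hcKA, hc⟩
    · left
      refine mem_filter.2 ⟨mem_univ _, by rw [card_insert_of_notMem hvK, hK4], v,
        mem_insert_self _ _, hvA, y, mem_insert_of_mem hyK, hyA, ?_, ?_⟩
      · rwa [erase_insert hvK]
      · rwa [erase_insert_of_ne (fun h : v = y => hvK (h ▸ hyK))]
    · right
      have hcK := (mem_inter.1 hcKA).1
      refine ⟨insert v (K.erase c), insert_subset_insert _ (erase_subset _ _), ?_, hc, ?_⟩
      · rw [card_insert_of_notMem (fun h => hvK (mem_of_mem_erase h)), card_erase_of_mem hcK, hK4]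
      · rw [insert_inter_of_notMem hvA, erase_inter, card_erase_of_mem hcKA, hKA]

/-- For `3`-graphs and `4`-cliques every large cut is crossed by many pairs of cliques. -/
lemma FewMissed.card_crossing_ge_three_four {γ g : ℝ} (hE : FewMissed 3 (1 / 4 - γ) E)
    (hγ : 0 < γ) (hγβ : γ < 1 / 4) (hg : 0 < g) (hgγ : g ≤ γ / 4) (hn : 4 ≤ g * n)
    (A : Finset (Fin n)) (hA : (#A : ℝ) ≤ n / 2) (hA2 : 2 * (g * n) ≤ #A) :
    (#A : ℝ) * (g * n / 2 ^ 5) ^ 4 ≤ #(crossing 3 4 E A) * (1 + 2 ^ 5 / g) := by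
  have hn0 : (0 : ℝ) ≤ n := Nat.cast_nonneg n
  have hgn : g * n ≤ γ / 4 * n := mul_le_mul_of_nonneg_right hgγ hn0
  set 𝓕 : ℕ → Finset (Finset (Fin n)) := fun p => univ.filter fun U => #U = p ∧ Clq 3 E U ∧
    (p ≤ 2 → U ⊆ A) ∧ (p = 3 → #(U ∩ A) = 2) ∧ (p = 4 → #(U ∩ A) = 3 ∨ #(U ∩ A) = 2) with h𝓕
  set 𝓜 : Finset (Finset (Fin n)) := univ.filter fun M => #M = 4 ∧ Clq 3 E M ∧ #(M ∩ A) = 2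
    with h𝓜
  set 𝓨 : Finset (Finset (Fin n)) := univ.filter fun Y => #Y = 5 ∧
    (Y ∈ crossing 3 4 E A ∨ ∃ M ∈ 𝓜, M ⊆ Y) with h𝓨
  have hmixed : ∀ M ∈ 𝓜, ∃ X : Finset (Fin n), g * n ≤ #X ∧
      ∀ v ∈ X, v ∉ M ∧ insert v M ∈ crossing 3 4 E A := by
    intro M hM
    obtain ⟨hM4, hMc, hMA⟩ := (mem_filter.1 hM).2
    have hcard : #(M ∩ A) + #(M \ A) = 4 := by
      rw [← hM4]; exact card_inter_add_card_sdiff M A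
    obtain ⟨X, hX, hv⟩ := hE.exists_crossing_extension (t := 4) (l := 1) hγ hγβ (by norm_num)
      (by norm_num) (by norm_num [Nat.choose]) (by push_cast; linarith) hM4 hMc (A := A)
      (by omega) (by omega)
    exact ⟨X, hgn.trans hX, hv⟩
  have h1 : #A ≤ #(𝓕 1) := by
    refine card_le_card_of_injOn (fun a => {a}) ?_ (fun a _ b _ h => by simpa using h)
    intro a ha
    have : Clq 3 E {a} := clq_of_card_lt (by rw [card_singleton]; omega)
    simpa [h𝓕, this] using ha
  have h2 := greedy_count 𝓕 (fun p U hU => (mem_filter.1 hU).2.1) 1 5 (g * n) (by positivity) 3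
    (by norm_num) ?_
  · have h3 := card_mul_le_of_extension' (𝓕 4) 𝓨 (m := 5) (t := 5) le_rfl (g := g * n)
      (fun U hU => (mem_filter.1 hU).2.1) ?_
    · have h4 := card_mul_le_of_extension' 𝓜 (crossing 3 4 E A) (m := 5) (t := 5) le_rfl
        (g := g * n) (fun U hU => card_of_mem_crossing hU) hmixed
      have h5 : #𝓨 ≤ #(crossing 3 4 E A) + #𝓜 * n := by
        have hsub : 𝓨 ⊆ crossing 3 4 E A ∪
            (𝓜 ×ˢ (univ : Finset (Fin n))).image fun q => insert q.2 q.1 := by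
          intro Y hY
          obtain ⟨hY5, h | ⟨M, hM, hMY⟩⟩ := (mem_filter.1 hY).2
          · exact mem_union_left _ h
          · refine mem_union_right _ (mem_image.2 ?_)
            have hM4 : #M = 4 := (mem_filter.1 hM).2.1
            obtain ⟨v, hv⟩ := card_eq_one.1 (show #(Y \ M) = 1 by
              rw [card_sdiff_of_subset hMY]; omega)
            refine ⟨(M, v), by simp [hM], ?_⟩
            rw [insert_eq, ← hv, sdiff_union_of_subset hMY]
        refine (card_le_card hsub).trans ((card_union_le _ _).trans ?_)
        refine Nat.add_le_add_left (card_image_le.trans ?_) _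
        rw [card_product, card_univ, Fintype.card_fin]
      have h6 : (#𝓨 : ℝ) ≤ #(crossing 3 4 E A) + #𝓜 * n := by exact_mod_cast h5
      have h7 : (#𝓜 : ℝ) * n ≤ #(crossing 3 4 E A) * (2 ^ 5 / g) := by
        rw [← mul_div_assoc, le_div_iff₀ hg]
        linarith
      calc (#A : ℝ) * (g * n / 2 ^ 5) ^ 4 = #A * (g * n / 2 ^ 5) ^ 3 * (g * n / 2 ^ 5) := by ring
        _ ≤ #(𝓕 1) * (g * n / 2 ^ 5) ^ 3 * (g * n / 2 ^ 5) := by gcongr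
        _ ≤ #(𝓕 4) * (g * n / 2 ^ 5) := by gcongr
        _ ≤ #𝓨 := h3
        _ ≤ #(crossing 3 4 E A) * (1 + 2 ^ 5 / g) := by linarith
    · intro K hK
      obtain ⟨hK4, hKc, -, -, hKA⟩ := (mem_filter.1 hK).2
      rcases hKA rfl with hKA | hKA
      · obtain ⟨X, hX, hv⟩ := hE.exists_extension_three_one hgγ hn hA hK4 hKc hKA
        refine ⟨X, hX, fun v hvX => ⟨(hv v hvX).1, mem_filter.2 ⟨mem_univ _, ?_, ?_⟩⟩⟩
        · rw [card_insert_of_notMem (hv v hvX).1, hK4]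
        · rcases (hv v hvX).2 with h | ⟨M, hMY, hM⟩
          · exact Or.inl h
          · exact Or.inr ⟨M, mem_filter.2 ⟨mem_univ _, hM⟩, hMY⟩
      · obtain ⟨X, hX, hv⟩ := hmixed K (mem_filter.2 ⟨mem_univ _, hK4, hKc, hKA⟩)
        exact ⟨X, hX, fun v hvX => ⟨(hv v hvX).1, mem_filter.2 ⟨mem_univ _,
          card_of_mem_crossing (hv v hvX).2, Or.inl (hv v hvX).2⟩⟩⟩
  · intro p hp1 hp U hU
    obtain ⟨hUp, hUc, hU2, hU3, -⟩ := (mem_filter.1 hU).2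
    have hp' : p = 1 ∨ p = 2 ∨ p = 3 := by omega
    rcases hp' with rfl | rfl | rfl
    · refine ⟨A \ U, ?_, fun v hv => ?_⟩
      · have : (#A : ℝ) ≤ #(A \ U) + #U := by exact_mod_cast card_le_card_sdiff_add_card
        rw [hUp] at this
        push_cast at this
        linarith
      · rw [mem_sdiff] at hv
        have hc : #(insert v U) = 2 := by rw [card_insert_of_notMem hv.2, hUp]
        exact ⟨hv.2, mem_filter.2 ⟨mem_univ _, hc, clq_of_card_lt (by omega),
          fun _ => insert_subset hv.1 (hU2 (by norm_num)), by norm_num, by norm_num⟩⟩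
    · obtain ⟨X, hX, hv⟩ := hE.exists_clique_extension U A hUc
      refine ⟨X, ?_, fun v hvX => ?_⟩
      · rw [hUp, show Nat.choose 2 (3 - 1) = 1 from rfl] at hX
        push_cast at hX
        linarith
      · obtain ⟨hvU, hvA, hvc⟩ := hv v hvX
        refine ⟨hvU, mem_filter.2 ⟨mem_univ _, by rw [card_insert_of_notMem hvU, hUp], hvc,
          by norm_num, fun _ => ?_, by norm_num⟩⟩
        rw [insert_inter_of_notMem hvA, inter_eq_left.2 (hU2 (by norm_num)), hUp]
    · obtain ⟨X, hX, hv⟩ := hE.exists_clique_extension U ∅ hUc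
      refine ⟨X, ?_, fun v hvX => ?_⟩
      · rw [hUp, show Nat.choose 3 (3 - 1) = 3 from rfl] at hX
        simp only [card_empty] at hX
        push_cast at hX
        linarith
      · obtain ⟨hvU, -, hvc⟩ := hv v hvX
        refine ⟨hvU, mem_filter.2 ⟨mem_univ _, by rw [card_insert_of_notMem hvU, hUp], hvc,
          by norm_num, by norm_num, fun _ => ?_⟩⟩
        by_cases hvA : v ∈ A
        · left
          rw [insert_inter_of_mem hvA, card_insert_of_notMem fun h => hvU (mem_inter.1 h).1,
            hU3 rfl]
        · right
          rw [insert_inter_of_notMem hvA, hU3 rfl]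

end FourVertices

section DisjointUnions

variable {α : Type*} [DecidableEq α]

/-- Counting the disjoint unions of members of two families. -/
lemma card_mul_le_of_disjoint_union (𝓕 𝓤 : Finset (Finset α)) (m : ℕ) (N : ℝ)
    (hU : ∀ U ∈ 𝓤, #U = m)
    (h : ∀ F ∈ 𝓕, ∃ 𝓖 : Finset (Finset α), N ≤ #𝓖 ∧ ∀ G ∈ 𝓖, Disjoint F G ∧ F ∪ G ∈ 𝓤) :
    (#𝓕 : ℝ) * N ≤ #𝓤 * 2 ^ m := by
  refine card_mul_le_card_mul_two_pow 𝓕 𝓤 m N hU fun F hF => ?_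
  obtain ⟨𝓖, h𝓖, hG⟩ := h F hF
  refine h𝓖.trans ?_
  norm_cast
  refine card_le_card_of_injOn (fun G => F ∪ G) ?_ ?_
  · intro G hGm
    simpa using (hG G hGm).2
  · intro G hGm G' hGm' hGG
    have h1 := (hG G hGm).1
    have h2 := (hG G' hGm').1
    have : (F ∪ G) \ F = (F ∪ G') \ F := by simp only at hGG; rw [hGG]
    rwa [union_sdiff_cancel_left h1, union_sdiff_cancel_left h2] at this

/-- A dense family of `q`-sets stays dense after discarding the sets that meet a small set. -/
lemma half_le_card_filter_disjoint {n q : ℕ} (hq : 1 ≤ q) {η : ℝ} (𝓖 : Finset (Finset (Fin n)))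
    (h𝓖 : ∀ G ∈ 𝓖, #G = q) (hη : η * (n : ℝ) ^ q ≤ #𝓖) (D : Finset (Fin n)) {m : ℝ}
    (hDm : (#D : ℝ) ≤ m) (hD : 2 * m ≤ η * n) :
    η / 2 * (n : ℝ) ^ q ≤ #{G ∈ 𝓖 | Disjoint D G} := by
  have h1 : ∀ d ∈ D, #{G ∈ 𝓖 | d ∈ G} ≤ n ^ (q - 1) := by
    intro d _
    have h2 : #{G ∈ 𝓖 | d ∈ G} ≤ #(powersetCard (q - 1) (univ : Finset (Fin n))) := by
      refine card_le_card_of_injOn (fun G => G.erase d) ?_ ?_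
      · intro G hG
        have hG' := mem_filter.1 (mem_coe.1 hG)
        refine mem_coe.2 (mem_powersetCard.2 ⟨subset_univ _, ?_⟩)
        rw [card_erase_of_mem hG'.2, h𝓖 G hG'.1]
      · intro G hG G' hG' h
        have h3 := (mem_filter.1 (mem_coe.1 hG)).2
        have h4 := (mem_filter.1 (mem_coe.1 hG')).2
        rw [← insert_erase h3, ← insert_erase h4]
        exact congrArg (insert d) h
    refine h2.trans ?_
    rw [card_powersetCard, card_univ, Fintype.card_fin]
    exact Nat.choose_le_pow n (q - 1)
  have h2 : #{G ∈ 𝓖 | ¬ Disjoint D G} ≤ #D * n ^ (q - 1) := by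
    have hsub : {G ∈ 𝓖 | ¬ Disjoint D G} ⊆ D.biUnion fun d => {G ∈ 𝓖 | d ∈ G} := by
      intro G hG
      obtain ⟨hG1, hG2⟩ := mem_filter.1 hG
      obtain ⟨d, hd, hdG⟩ := not_disjoint_iff.1 hG2
      exact mem_biUnion.2 ⟨d, hd, mem_filter.2 ⟨hG1, hdG⟩⟩
    refine (card_le_card hsub).trans (card_biUnion_le.trans ?_)
    rw [← smul_eq_mul]
    exact sum_le_card_nsmul _ _ _ h1
  have h3 := card_filter_add_card_filter_not (s := 𝓖) (fun G => Disjoint D G)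
  have h4 : (#𝓖 : ℝ) ≤ #{G ∈ 𝓖 | Disjoint D G} + #D * (n : ℝ) ^ (q - 1) := by
    rw [← h3]
    push_cast
    have : (#{G ∈ 𝓖 | ¬ Disjoint D G} : ℝ) ≤ #D * (n : ℝ) ^ (q - 1) := by exact_mod_cast h2
    linarith
  have h5 : (n : ℝ) ^ q = n * (n : ℝ) ^ (q - 1) := by
    rw [← pow_succ', Nat.sub_add_cancel hq]
  have h6 : (#D : ℝ) * (n : ℝ) ^ (q - 1) ≤ η / 2 * n * (n : ℝ) ^ (q - 1) := by
    gcongr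
    linarith
  rw [h5] at hη ⊢
  linarith

end DisjointUnions

/-- If the values of `f` are at most `M` and their sum is large, then many are at least `η`. -/
lemma sum_le_card_filter_mul_add {ι : Type*} (s : Finset ι) (f : ι → ℝ) {M η : ℝ} (hη : 0 ≤ η)
    (hf : ∀ i ∈ s, f i ≤ M) : ∑ i ∈ s, f i ≤ #{i ∈ s | η ≤ f i} * M + #s * η := by
  rw [← sum_filter_add_sum_filter_not s (fun i => η ≤ f i)]
  refine add_le_add ?_ ?_
  · rw [← nsmul_eq_mul]
    exact sum_le_card_nsmul _ _ _ fun i hi => hf i (mem_filter.1 hi).1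
  · have h1 : ∑ i ∈ s with ¬ η ≤ f i, f i ≤ #{i ∈ s | ¬ η ≤ f i} * η := by
      rw [← nsmul_eq_mul]
      exact sum_le_card_nsmul _ _ _ fun i hi => (not_le.1 (mem_filter.1 hi).2).le
    refine h1.trans ?_
    gcongr
    exact filter_subset _ _

section Closeness

variable {n : ℕ} {V : Type} [Fintype V] [DecidableEq V] {E : Finset (Finset (Fin n))}
  {EF : Finset (Finset V)}

/-- The sets witnessing that `x` is close to `y`. -/
def linkSets (E : Finset (Finset (Fin n))) (EF : Finset (Finset V)) (i : ℕ) (x y : Fin n) :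
    Finset (Finset (Fin n)) :=
  {S | #S = i * Fintype.card V - 1 ∧ x ∉ S ∧ y ∉ S ∧
    HasFactorOn E EF (insert x S) ∧ HasFactorOn E EF (insert y S)}

lemma mem_linkSets {i : ℕ} {x y : Fin n} {S : Finset (Fin n)} :
    S ∈ linkSets E EF i x y ↔ #S = i * Fintype.card V - 1 ∧ x ∉ S ∧ y ∉ S ∧
      HasFactorOn E EF (insert x S) ∧ HasFactorOn E EF (insert y S) := by
  simp [linkSets]

lemma closeTo_iff {i : ℕ} {η : ℝ} {x y : Fin n} : CloseTo E EF i η x y ↔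
    η * (n : ℝ) ^ (i * Fintype.card V - 1) ≤ #(linkSets E EF i x y) := by
  rw [CloseTo, ← Set.ncard_coe_finset]
  simp [linkSets]

lemma CloseTo.symm {i : ℕ} {η : ℝ} {x y : Fin n} (h : CloseTo E EF i η x y) :
    CloseTo E EF i η y x := by
  rw [closeTo_iff] at h ⊢
  rwa [show linkSets E EF i y x = linkSets E EF i x y by ext S; simp only [mem_linkSets]; tauto]

lemma CloseTo.mono {i : ℕ} {η η' : ℝ} {x y : Fin n} (h : CloseTo E EF i η x y) (hη : η' ≤ η) :
    CloseTo E EF i η' x y :=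
  le_trans (by gcongr) h

lemma card_linkSets_le (i : ℕ) (x y : Fin n) :
    #(linkSets E EF i x y) ≤ n ^ (i * Fintype.card V - 1) := by
  have h : linkSets E EF i x y ⊆ powersetCard (i * Fintype.card V - 1) univ := fun S hS =>
    mem_powersetCard.2 ⟨subset_univ _, (mem_linkSets.1 hS).1⟩
  refine (card_le_card h).trans ?_
  rw [card_powersetCard, card_univ, Fintype.card_fin]
  exact Nat.choose_le_pow n _

lemma IsCopy.hasFactorOn {A : Finset (Fin n)} (h : IsCopy E EF A) : HasFactorOn E EF A :=
  ⟨{A}, by simpa using h, by simp, by simp⟩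

lemma IsCopy.card_eq {A : Finset (Fin n)} (h : IsCopy E EF A) : #A = Fintype.card V := by
  obtain ⟨f, rfl, -⟩ := h
  rw [card_map, card_univ]

lemma HasFactorOn.union {S T : Finset (Fin n)} (hS : HasFactorOn E EF S)
    (hT : HasFactorOn E EF T) (h : Disjoint S T) : HasFactorOn E EF (S ∪ T) := by
  obtain ⟨P, hP1, hP2, rfl⟩ := hS
  obtain ⟨Q, hQ1, hQ2, rfl⟩ := hT
  refine ⟨P ∪ Q, fun A hA => (mem_union.1 hA).elim (hP1 A) (hQ1 A), ?_, by rw [union_biUnion]⟩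
  rw [coe_union, Set.pairwiseDisjoint_union]
  exact ⟨hP2, hQ2, fun A hA B hB _ =>
    h.mono (subset_biUnion_of_mem id hA) (subset_biUnion_of_mem id hB)⟩

lemma HasFactorOn.of_eq {S T : Finset (Fin n)} (hS : HasFactorOn E EF S) (h : S = T) :
    HasFactorOn E EF T := h ▸ hS

end Closeness

/-- Closeness composes through linearly many intermediate vertices. -/
lemma exists_closeTo_comp {V : Type} [Fintype V] [DecidableEq V] (EF : Finset (Finset V))
    (hV : 2 ≤ Fintype.card V) {i j : ℕ} (hi : 1 ≤ i) (hj : 1 ≤ j) {η₁ η₂ μ : ℝ} (h₁ : 0 < η₁)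
    (h₂ : 0 < η₂) (hμ : 0 < μ) :
    ∃ η : ℝ, 0 < η ∧ ∃ n₀ : ℕ, ∀ n : ℕ, n₀ ≤ n → ∀ (E : Finset (Finset (Fin n))) (x y : Fin n)
      (Z : Finset (Fin n)), μ * n ≤ #Z →
      (∀ z ∈ Z, CloseTo E EF i η₁ x z ∧ CloseTo E EF j η₂ z y) →
      CloseTo E EF (i + j) η x y := by
  set s := Fintype.card V with hs
  set p := i * s - 1 with hp
  set q := j * s - 1 with hq
  have his : 2 ≤ i * s := by nlinarith
  have hjs : 2 ≤ j * s := by nlinarith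
  have hpq : (i + j) * s - 1 = p + 1 + q := by rw [add_mul]; omega
  refine ⟨μ / 2 * (η₁ / 2) * (η₂ / 2) / 2 ^ (p + 1) / 2 ^ (p + 1 + q), by positivity,
    ⌈4 / μ⌉₊ + ⌈2 / η₁⌉₊ + ⌈2 * (p + 2) / η₂⌉₊, fun n hn E x y Z hZ hclose => ?_⟩
  have hn1 : (⌈4 / μ⌉₊ : ℝ) + ⌈2 / η₁⌉₊ + ⌈2 * (p + 2) / η₂⌉₊ ≤ n := by exact_mod_cast hn
  have hc1 := Nat.le_ceil (4 / μ)
  have hc2 := Nat.le_ceil (2 / η₁)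
  have hc3 := Nat.le_ceil (2 * ((p : ℝ) + 2) / η₂)
  have hp1 : (0 : ℝ) ≤ (⌈4 / μ⌉₊ : ℝ) := Nat.cast_nonneg _
  have hp2 : (0 : ℝ) ≤ (⌈2 / η₁⌉₊ : ℝ) := Nat.cast_nonneg _
  have hp3 : (0 : ℝ) ≤ (⌈2 * ((p : ℝ) + 2) / η₂⌉₊ : ℝ) := Nat.cast_nonneg _
  have hnμ : 4 ≤ μ * n := by rw [mul_comm, ← div_le_iff₀ hμ]; linarith
  have hnη₁ : 2 ≤ η₁ * n := by rw [mul_comm, ← div_le_iff₀ h₁]; linarith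
  have hnη₂ : 2 * ((p : ℝ) + 2) ≤ η₂ * n := by rw [mul_comm η₂, ← div_le_iff₀ h₂]; linarith
  rw [closeTo_iff, hpq]
  set Z' := Z \ {x, y} with hZ'
  have hZ'c : μ / 2 * n ≤ #Z' := by
    have h3 : (#Z : ℝ) ≤ #Z' + #({x, y} : Finset (Fin n)) := by
      exact_mod_cast card_le_card_sdiff_add_card
    have h4 : (#({x, y} : Finset (Fin n)) : ℝ) ≤ 2 := by exact_mod_cast card_le_two
    linarith
  set 𝓦 : Finset (Finset (Fin n)) := {W | #W = p + 1 ∧ y ∉ W ∧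
    ∃ z ∈ W, z ∈ Z' ∧ W.erase z ∈ linkSets E EF i x z} with h𝓦
  have hstep1 : (#(Z'.image fun z => ({z} : Finset (Fin n))) : ℝ) * (η₁ / 2 * (n : ℝ) ^ p) ≤
      #𝓦 * 2 ^ (p + 1) := by
    refine card_mul_le_of_disjoint_union _ _ _ _ (fun W hW => (mem_filter.1 hW).2.1) ?_
    intro F hF
    obtain ⟨z, hz, rfl⟩ := mem_image.1 hF
    obtain ⟨hzZ, hzxy⟩ := mem_sdiff.1 hz
    have hcount : η₁ / 2 * (n : ℝ) ^ p ≤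
        #{S ∈ linkSets E EF i x z | Disjoint ({y} : Finset (Fin n)) S} := by
      refine half_le_card_filter_disjoint (q := p) (by omega) (linkSets E EF i x z)
        (fun S hS => (mem_linkSets.1 hS).1) (closeTo_iff.1 (hclose z hzZ).1) {y} (m := 1) ?_ ?_
      · rw [card_singleton, Nat.cast_one]
      · linarith
    refine ⟨_, hcount, fun S hS => ?_⟩
    obtain ⟨hS, hyS⟩ := mem_filter.1 hS
    have hzS := (mem_linkSets.1 hS).2.2.1
    have hyS' : y ∉ S := disjoint_singleton_left.1 hyS
    refine ⟨disjoint_singleton_left.2 hzS, mem_filter.2 ⟨mem_univ _, ?_, ?_, z, ?_, hz, ?_⟩⟩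
    · rw [← insert_eq, card_insert_of_notMem hzS, (mem_linkSets.1 hS).1]
    · rw [← insert_eq, mem_insert]
      rintro (rfl | h)
      · simp at hzxy
      · exact hyS' h
    · simp
    · rwa [← insert_eq, erase_insert hzS]
  rw [card_image_of_injective _ singleton_injective] at hstep1
  have hstep2 : (#𝓦 : ℝ) * (η₂ / 2 * (n : ℝ) ^ q) ≤
      #(linkSets E EF (i + j) x y) * 2 ^ (p + 1 + q) := by
    refine card_mul_le_of_disjoint_union _ _ _ _
      (fun W hW => by rw [(mem_linkSets.1 hW).1, ← hpq]) ?_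
    intro W hW
    obtain ⟨hWc, hyW, z, hzW, hzZ', hlink⟩ := (mem_filter.1 hW).2
    obtain ⟨hzZ, hzxy⟩ := mem_sdiff.1 hzZ'
    obtain ⟨-, hxW, -, hf1, hf2⟩ := mem_linkSets.1 hlink
    have hzx : x ≠ z := by rintro rfl; simp at hzxy
    have hzy : y ≠ z := by rintro rfl; simp at hzxy
    have hxW' : x ∉ W := fun h => hxW (mem_erase.2 ⟨hzx, h⟩)
    refine ⟨{S ∈ linkSets E EF j z y | Disjoint (insert x W) S},
      half_le_card_filter_disjoint (q := q) (by omega) (linkSets E EF j z y)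
      (fun S hS => (mem_linkSets.1 hS).1) (closeTo_iff.1 (hclose z hzZ).2) _ (m := p + 2) ?_
      hnη₂, fun S hS => ?_⟩
    · rw [card_insert_of_notMem hxW', hWc]; push_cast; linarith
    obtain ⟨hS, hdis⟩ := mem_filter.1 hS
    obtain ⟨hSc, hzS, hyS, hf3, hf4⟩ := mem_linkSets.1 hS
    obtain ⟨hxS, hWS⟩ := disjoint_insert_left.1 hdis
    refine ⟨hWS, mem_linkSets.2 ⟨?_, ?_, ?_, ?_, ?_⟩⟩
    · rw [card_union_of_disjoint hWS, hWc, hSc, ← hs, hpq]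
    · simp [hxW', hxS]
    · simp [hyW, hyS]
    · refine (hf1.union hf3 ?_).of_eq ?_
      · rw [disjoint_insert_left, disjoint_insert_right]
        refine ⟨?_, notMem_erase _ _, hWS.mono_left (erase_subset _ _)⟩
        rw [mem_insert]; tauto
      · ext v
        simp only [mem_union, mem_insert, mem_erase]
        by_cases hv : v = z
        · subst hv; simp [hzW]
        · simp [hv]; tauto
    · refine (hf2.union hf4 ?_).of_eq ?_
      · rw [insert_erase hzW, disjoint_insert_right]
        exact ⟨hyW, hWS⟩
      · rw [insert_erase hzW, union_insert]
  have h5 : (0 : ℝ) < 2 ^ (p + 1) := by positivity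
  have h6 : (0 : ℝ) < 2 ^ (p + 1 + q) := by positivity
  rw [div_mul_eq_mul_div, div_le_iff₀ h6]
  refine le_trans ?_ hstep2
  rw [div_mul_eq_mul_div, div_le_iff₀ h5]
  calc μ / 2 * (η₁ / 2) * (η₂ / 2) * (n : ℝ) ^ (p + 1 + q)
      = (μ / 2 * n) * (η₁ / 2 * (n : ℝ) ^ p) * (η₂ / 2 * (n : ℝ) ^ q) := by ring
    _ ≤ #Z' * (η₁ / 2 * (n : ℝ) ^ p) * (η₂ / 2 * (n : ℝ) ^ q) := by gcongr
    _ ≤ #𝓦 * 2 ^ (p + 1) * (η₂ / 2 * (n : ℝ) ^ q) := by gcongr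
    _ = #𝓦 * (η₂ / 2 * (n : ℝ) ^ q) * 2 ^ (p + 1) := by ring

/-- In a hypergraph with many copies of `F`, closeness passes to the next index. -/
lemma exists_closeTo_succ {V : Type} [Fintype V] [DecidableEq V] (EF : Finset (Finset V))
    (hV : 2 ≤ Fintype.card V) {i : ℕ} (hi : 1 ≤ i) {η₁ κ : ℝ} (h₁ : 0 < η₁) (hκ : 0 < κ) :
    ∃ η : ℝ, 0 < η ∧ ∃ n₀ : ℕ, ∀ n : ℕ, n₀ ≤ n → ∀ (E : Finset (Finset (Fin n))),
      κ * (n : ℝ) ^ Fintype.card V ≤ #{K | IsCopy E EF K} → ∀ x y : Fin n,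
      CloseTo E EF i η₁ x y → CloseTo E EF (i + 1) η x y := by
  set s := Fintype.card V with hs
  set p := i * s - 1 with hp
  have his : 2 ≤ i * s := by nlinarith
  have hps : (i + 1) * s - 1 = p + s := by rw [add_mul]; omega
  refine ⟨η₁ * (κ / 2) / 2 ^ (p + s), by positivity, ⌈2 * (p + 2) / κ⌉₊,
    fun n hn E hcopy x y hxy => ?_⟩
  have hn1 : (⌈2 * (p + 2) / κ⌉₊ : ℝ) ≤ n := by exact_mod_cast hn
  have hnκ : 2 * ((p : ℝ) + 2) ≤ κ * n := by
    rw [mul_comm κ, ← div_le_iff₀ hκ]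
    exact (Nat.le_ceil _).trans hn1
  rw [closeTo_iff, hps]
  rw [closeTo_iff] at hxy
  have hstep : (#(linkSets E EF i x y) : ℝ) * (κ / 2 * (n : ℝ) ^ s) ≤
      #(linkSets E EF (i + 1) x y) * 2 ^ (p + s) := by
    refine card_mul_le_of_disjoint_union _ _ _ _
      (fun W hW => by rw [(mem_linkSets.1 hW).1, ← hps]) ?_
    intro S hS
    obtain ⟨hSc, hxS, hyS, hf1, hf2⟩ := mem_linkSets.1 hS
    refine ⟨{K ∈ ({K | IsCopy E EF K} : Finset (Finset (Fin n))) |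
        Disjoint (insert x (insert y S)) K},
      half_le_card_filter_disjoint (by omega) _ (fun K hK => (mem_filter.1 hK).2.card_eq) hcopy _
      (m := p + 2) ?_ hnκ, fun K hK => ?_⟩
    · have h1 := card_insert_le x (insert y S)
      have h2 := card_insert_le y S
      have h3 : #(insert x (insert y S)) ≤ p + 2 := by rw [hSc, ← hs, ← hp] at h2; omega
      exact_mod_cast h3
    obtain ⟨hK, hdis⟩ := mem_filter.1 hK
    have hKc := (mem_filter.1 hK).2
    obtain ⟨hxK, hdis⟩ := disjoint_insert_left.1 hdis
    obtain ⟨hyK, hdis⟩ := disjoint_insert_left.1 hdis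
    refine ⟨hdis, mem_linkSets.2 ⟨?_, ?_, ?_, ?_, ?_⟩⟩
    · rw [card_union_of_disjoint hdis, hSc, hKc.card_eq, ← hs, hps]
    · simp [hxS, hxK]
    · simp [hyS, hyK]
    · exact (hf1.union hKc.hasFactorOn (disjoint_insert_left.2 ⟨hxK, hdis⟩)).of_eq
        (insert_union _ _ _)
    · exact (hf2.union hKc.hasFactorOn (disjoint_insert_left.2 ⟨hyK, hdis⟩)).of_eq
        (insert_union _ _ _)
  have h6 : (0 : ℝ) < 2 ^ (p + s) := by positivity
  rw [div_mul_eq_mul_div, div_le_iff₀ h6]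
  refine le_trans ?_ hstep
  calc η₁ * (κ / 2) * (n : ℝ) ^ (p + s)
      = (η₁ * (n : ℝ) ^ p) * (κ / 2 * (n : ℝ) ^ s) := by ring
    _ ≤ _ := by gcongr

/-- The hypotheses under which the sets of close vertices keep growing. -/
structure Expands {n : ℕ} {V : Type} [Fintype V] [DecidableEq V] (E : Finset (Finset (Fin n)))
    (EF : Finset (Finset V)) (κ ε η δ : ℝ) : Prop where
  copies : κ * (n : ℝ) ^ Fintype.card V ≤ #{K | IsCopy E EF K}
  base : ∀ x : Fin n, ε * n ≤ #{y | CloseTo E EF 1 η x y}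
  cut : ∀ A : Finset (Fin n), ε * n ≤ #A → (#A : ℝ) ≤ (1 - ε) * n →
    δ * n ≤ #{b | b ∉ A ∧ δ * n ≤ #{a ∈ A | CloseTo E EF 1 η a b}}

lemma Expands.exists_close_card {V : Type} [Fintype V] [DecidableEq V] (EF : Finset (Finset V))
    (hV : 2 ≤ Fintype.card V) {κ ε η δ : ℝ} (hκ : 0 < κ) (hη : 0 < η) (hδ : 0 < δ)
    (hε : ε ≤ 1 / 4) (r : ℕ) :
    ∃ η' : ℝ, 0 < η' ∧ ∃ n₀ : ℕ, ∀ n : ℕ, n₀ ≤ n → ∀ E : Finset (Finset (Fin n)),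
      Expands E EF κ ε η δ → ∀ x : Fin n,
      min (1 - ε) (ε + r * δ) * n ≤ #{y | CloseTo E EF (r + 1) η' x y} := by
  induction r with
  | zero =>
    refine ⟨η, hη, 0, fun n _ E hE x => le_trans ?_ (hE.base x)⟩
    gcongr
    simp
  | succ r ih =>
    obtain ⟨η₁, hη₁, n₁, h₁⟩ := ih
    obtain ⟨η₂, hη₂, n₂, h₂⟩ := exists_closeTo_succ EF hV (i := r + 1) (by omega) hη₁ hκ
    obtain ⟨η₃, hη₃, n₃, h₃⟩ := exists_closeTo_comp EF hV (i := r + 1) (j := 1) (by omega)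
      (by omega) hη₁ hη hδ
    refine ⟨min η₂ η₃, lt_min hη₂ hη₃, n₁ + n₂ + n₃, fun n hn E hE x => ?_⟩
    have hX := h₁ n (by omega) E hE x
    set X : Finset (Fin n) := {y | CloseTo E EF (r + 1) η₁ x y} with hXdef
    have hn0 : (0 : ℝ) ≤ n := Nat.cast_nonneg n
    have hsub : X ⊆ univ.filter fun y => CloseTo E EF (r + 1 + 1) (min η₂ η₃) x y := by
      intro y hy
      rw [mem_filter] at hy ⊢
      exact ⟨mem_univ _, (h₂ n (by omega) E hE.copies x y hy.2).mono (min_le_left _ _)⟩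
    rcases le_total ((1 - ε) * (n : ℝ)) #X with hbig | hsmall
    · refine le_trans ?_ (hbig.trans (Nat.cast_le.2 (card_le_card hsub)))
      gcongr
      exact min_le_left _ _
    · have hr : 0 ≤ (r : ℝ) * δ := by positivity
      have hεX : ε * n ≤ #X := by
        refine le_trans ?_ hX
        gcongr
        exact le_min (by linarith) (by linarith)
      have hcut := hE.cut X hεX hsmall
      set B : Finset (Fin n) := {b | b ∉ X ∧ δ * n ≤ #{a ∈ X | CloseTo E EF 1 η a b}} with hB
      have hsub2 : B ⊆ univ.filter fun y => CloseTo E EF (r + 1 + 1) (min η₂ η₃) x y := by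
        intro b hb
        obtain ⟨-, hb⟩ := (mem_filter.1 hb).2
        refine mem_filter.2 ⟨mem_univ _, CloseTo.mono (η := η₃) ?_ (min_le_right _ _)⟩
        refine h₃ n (by omega) E x b _ hb fun z hz => ?_
        obtain ⟨hz1, hz2⟩ := mem_filter.1 hz
        exact ⟨(mem_filter.1 hz1).2, hz2⟩
      have hdis : Disjoint X B :=
        disjoint_right.2 fun b hb => (mem_filter.1 hb).2.1
      have hcard := card_le_card (union_subset hsub hsub2)
      rw [card_union_of_disjoint hdis] at hcard
      have hcard' : (#X : ℝ) + #B ≤ #{y | CloseTo E EF (r + 1 + 1) (min η₂ η₃) x y} := by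
        exact_mod_cast hcard
      refine le_trans ?_ hcard'
      have hmin : min (1 - ε) (ε + (r + 1 : ℕ) * δ) ≤ min (1 - ε) (ε + r * δ) + δ := by
        push_cast
        rcases le_total (1 - ε) (ε + r * δ) with h | h
        · rw [min_eq_left h]
          exact (min_le_left _ _).trans (by linarith)
        · rw [min_eq_right h]
          exact (min_le_right _ _).trans (by linarith)
      calc min (1 - ε) (ε + (r + 1 : ℕ) * δ) * n ≤ (min (1 - ε) (ε + r * δ) + δ) * n := by gcongr
        _ ≤ #X + #B := by linarith

lemma Expands.exists_isClosedGraph {V : Type} [Fintype V] [DecidableEq V]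
    (EF : Finset (Finset V)) (hV : 2 ≤ Fintype.card V) {κ ε η δ : ℝ} (hκ : 0 < κ) (hη : 0 < η)
    (hδ : 0 < δ) (hε0 : 0 ≤ ε) (hε : ε ≤ 1 / 4) :
    ∃ i : ℕ, 1 ≤ i ∧ ∃ η' : ℝ, 0 < η' ∧ ∃ n₀ : ℕ, ∀ n : ℕ, n₀ ≤ n →
      ∀ E : Finset (Finset (Fin n)), Expands E EF κ ε η δ → IsClosedGraph E EF i η' := by
  set R := ⌈1 / δ⌉₊ with hR
  obtain ⟨η₁, hη₁, n₁, h₁⟩ := Expands.exists_close_card EF hV hκ hη hδ hε R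
  obtain ⟨η₂, hη₂, n₂, h₂⟩ := exists_closeTo_comp EF hV (i := R + 1) (j := R + 1) (by omega)
    (by omega) hη₁ hη₁ (μ := 1 / 2) (by norm_num)
  refine ⟨R + 1 + (R + 1), by omega, η₂, hη₂, n₁ + n₂, fun n hn E hE x y _ => ?_⟩
  have hRδ : 1 ≤ (R : ℝ) * δ := by
    rw [← div_le_iff₀ hδ]
    exact Nat.le_ceil _
  have hx := h₁ n (by omega) E hE x
  have hy := h₁ n (by omega) E hE y
  rw [min_eq_left (by linarith)] at hx hy
  have hn0 : (0 : ℝ) ≤ n := Nat.cast_nonneg n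
  have hεn : ε * n ≤ 1 / 4 * n := mul_le_mul_of_nonneg_right hε hn0
  set X : Finset (Fin n) := {z | CloseTo E EF (R + 1) η₁ x z} with hX
  set Y : Finset (Fin n) := {z | CloseTo E EF (R + 1) η₁ y z} with hY
  refine h₂ n (by omega) E x y (X ∩ Y) ?_ fun z hz => ?_
  · have h3 : (#(X ∪ Y) : ℝ) ≤ n := by
      exact_mod_cast (card_le_univ (X ∪ Y)).trans_eq (Fintype.card_fin n)
    have h4 : (#(X ∪ Y) : ℝ) + #(X ∩ Y) = #X + #Y := by
      exact_mod_cast card_union_add_card_inter X Y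
    linarith
  · obtain ⟨hzX, hzY⟩ := mem_inter.1 hz
    exact ⟨(mem_filter.1 hzX).2, (mem_filter.1 hzY).2.symm⟩

section CliqueCopies

variable {n k t : ℕ} {E : Finset (Finset (Fin n))}

lemma Clq.isCopy {K : Finset (Fin n)} (hK : Clq k E K) (hKt : #K = t) :
    IsCopy E (cliqueEdges t k) K := by
  refine ⟨(K.orderEmbOfFin hKt).toEmbedding, ?_, fun e he => ?_⟩
  · rw [map_orderEmbOfFin_univ]
  · refine hK _ ?_ (by rw [card_map]; exact (mem_powersetCard.1 he).2)
    intro v hv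
    obtain ⟨j, -, rfl⟩ := mem_map.1 hv
    exact orderEmbOfFin_mem K hKt j

lemma Clq.mem_linkSets_one {S : Finset (Fin n)} {x y : Fin n} (hS : #S = t - 1) (ht : 1 ≤ t)
    (hx : x ∉ S) (hy : y ∉ S) (hxS : Clq k E (insert x S)) (hyS : Clq k E (insert y S)) :
    S ∈ linkSets E (cliqueEdges t k) 1 x y := by
  rw [mem_linkSets, Fintype.card_fin, one_mul]
  refine ⟨hS, hx, hy, (hxS.isCopy ?_).hasFactorOn, (hyS.isCopy ?_).hasFactorOn⟩
  · rw [card_insert_of_notMem hx]; omega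
  · rw [card_insert_of_notMem hy]; omega

lemma crossing_compl (A : Finset (Fin n)) : crossing k t E Aᶜ = crossing k t E A := by
  ext Y
  simp only [crossing, mem_filter, mem_univ, true_and, mem_compl, not_not]
  constructor
  · rintro ⟨h, a, ha, haA, b, hb, hbA, h1, h2⟩
    exact ⟨h, b, hb, hbA, a, ha, haA, h2, h1⟩
  · rintro ⟨h, a, ha, haA, b, hb, hbA, h1, h2⟩
    exact ⟨h, b, hb, hbA, a, ha, haA, h2, h1⟩

lemma card_crossing_le_sum (ht : 1 ≤ t) (A : Finset (Fin n)) :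
    #(crossing k t E A) ≤
      ∑ q ∈ Aᶜ ×ˢ A, #(linkSets E (cliqueEdges t k) 1 q.2 q.1) := by
  have hsub : crossing k t E A ⊆ (Aᶜ ×ˢ A).biUnion fun q =>
      (linkSets E (cliqueEdges t k) 1 q.2 q.1).image fun S => insert q.1 (insert q.2 S) := by
    intro Y hY
    obtain ⟨hYc, a, ha, haA, b, hb, hbA, h1, h2⟩ := (mem_filter.1 hY).2
    have hab : a ≠ b := fun h => hbA (h ▸ haA)
    have hba' : b ∈ Y.erase a := mem_erase.2 ⟨hab.symm, hb⟩
    have hab' : a ∈ Y.erase b := mem_erase.2 ⟨hab, ha⟩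
    refine mem_biUnion.2 ⟨(b, a), by simp [haA, hbA], mem_image.2 ⟨(Y.erase b).erase a, ?_, ?_⟩⟩
    · refine Clq.mem_linkSets_one ?_ ht (by simp) (by simp) ?_ ?_
      · rw [card_erase_of_mem hab', card_erase_of_mem hb, hYc]; omega
      · simpa only [insert_erase hab'] using h2
      · simp only
        rwa [erase_right_comm, insert_erase hba']
    · simp only
      rw [insert_erase hab', insert_erase hb]
  exact (card_le_card hsub).trans (card_biUnion_le.trans (sum_le_sum fun q _ => card_image_le))

lemma card_filter_closeTo_ge (ht : 1 ≤ t) {κ : ℝ} (hκ : 0 ≤ κ) (A : Finset (Fin n))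
    (h : κ * (n : ℝ) ^ (t + 1) ≤ #(crossing k t E A)) :
    κ / 4 * n ≤ #{b | b ∉ A ∧
      κ / 4 * n ≤ #{a ∈ A | CloseTo E (cliqueEdges t k) 1 (κ / 4) a b}} := by
  rcases Nat.eq_zero_or_pos n with rfl | hn
  · simp
  have hn0 : (0 : ℝ) < n := by exact_mod_cast hn
  have hA : (#A : ℝ) ≤ n := by exact_mod_cast (card_le_univ A).trans_eq (Fintype.card_fin n)
  have hAc : (#(Aᶜ) : ℝ) ≤ n := by exact_mod_cast (card_le_univ _).trans_eq (Fintype.card_fin n)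
  have h1 : (#(crossing k t E A) : ℝ) ≤ ∑ b ∈ Aᶜ, ∑ a ∈ A,
      (#(linkSets E (cliqueEdges t k) 1 a b) : ℝ) := by
    rw [← sum_product' Aᶜ A fun b a => (#(linkSets E (cliqueEdges t k) 1 a b) : ℝ)]
    exact_mod_cast card_crossing_le_sum ht A
  set d : Fin n → ℝ := fun b => #{a ∈ A | CloseTo E (cliqueEdges t k) 1 (κ / 4) a b} with hd
  have h2 : ∀ b ∈ Aᶜ, ∑ a ∈ A, (#(linkSets E (cliqueEdges t k) 1 a b) : ℝ) ≤
      d b * (n : ℝ) ^ (t - 1) + n * (κ / 4 * (n : ℝ) ^ (t - 1)) := by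
    intro b _
    have h3 := sum_le_card_filter_mul_add A
      (fun a => (#(linkSets E (cliqueEdges t k) 1 a b) : ℝ)) (M := (n : ℝ) ^ (t - 1))
      (η := κ / 4 * (n : ℝ) ^ (t - 1)) (by positivity) (fun a _ => by
        have := card_linkSets_le (E := E) (EF := cliqueEdges t k) 1 a b
        rw [Fintype.card_fin, one_mul] at this
        exact_mod_cast this)
    refine h3.trans (add_le_add (le_of_eq ?_) (by gcongr))
    simp only [hd, closeTo_iff, Fintype.card_fin, one_mul]
  have h4 : κ * (n : ℝ) ^ (t + 1) ≤
      (∑ b ∈ Aᶜ, d b) * (n : ℝ) ^ (t - 1) + n * (n * (κ / 4 * (n : ℝ) ^ (t - 1))) := by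
    refine h.trans (h1.trans ((sum_le_sum h2).trans ?_))
    rw [sum_add_distrib, sum_mul, sum_const, nsmul_eq_mul]
    gcongr
  have h5 : ∑ b ∈ Aᶜ, d b ≤ #{b ∈ Aᶜ | κ / 4 * n ≤ d b} * (n : ℝ) + n * (κ / 4 * n) := by
    refine (sum_le_card_filter_mul_add Aᶜ d (M := (n : ℝ)) (η := κ / 4 * n) (by positivity)
      fun b _ => ?_).trans (by gcongr)
    refine le_trans ?_ hA
    simp only [hd]
    exact_mod_cast card_filter_le _ _
  have h6 : ({b | b ∉ A ∧ κ / 4 * n ≤ #{a ∈ A | CloseTo E (cliqueEdges t k) 1 (κ / 4) a b}} :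
      Finset (Fin n)) = {b ∈ Aᶜ | κ / 4 * n ≤ d b} := by
    ext b
    simp [hd]
  rw [h6]
  have h7 : (n : ℝ) ^ (t + 1) = n * n * (n : ℝ) ^ (t - 1) := by
    rw [← pow_two, ← pow_add]; congr 1; omega
  rw [h7] at h4
  have h8 : (0 : ℝ) < (n : ℝ) ^ (t - 1) := by positivity
  have h9 : κ * n * n ≤ (∑ b ∈ Aᶜ, d b) + κ / 4 * n * n := by
    refine le_of_mul_le_mul_right ?_ h8
    linarith
  refine le_of_mul_le_mul_right ?_ hn0
  nlinarith

end CliqueCopies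

section BaseCase

variable {n k t : ℕ} {E : Finset (Finset (Fin n))}

lemma FewMissed.card_closeTo_one_ge {β γ g : ℝ} (hE : FewMissed k (β - γ) E) (hk : 2 ≤ k)
    (hkt : k < t) (hγ : 0 < γ) (hβγ : γ < β) (hβ : ((t - 1).choose (k - 1) : ℝ) * β ≤ 1)
    (hg : 0 < g) (hgγ : g ≤ γ / 4) (hn : t ≤ g * n) (x : Fin n) :
    (g / 2 ^ (t + 1)) ^ (t - 1) * g / 2 * n ≤
      #{y | CloseTo E (cliqueEdges t k) 1 ((g / 2 ^ (t + 1)) ^ (t - 1) * g / 2) x y} := by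
  set c : ℝ := (g / 2 ^ (t + 1)) ^ (t - 1) with hc
  have hc0 : 0 < c := by positivity
  have hn0 : (0 : ℝ) < n := by exact_mod_cast x.pos
  have hgn : g * n ≤ γ / 4 * n := mul_le_mul_of_nonneg_right hgγ hn0.le
  set 𝒬 : Finset (Finset (Fin n)) := {Q | #Q = t - 1 ∧ x ∉ Q ∧ Clq k E (insert x Q)} with h𝒬
  have h1 : c * (n : ℝ) ^ (t - 1) ≤ #𝒬 := by
    have h2 := hE.card_cliques_meeting hk hkt hγ hβγ hβ hg hgγ hn {x}
    have h3 : #({U | #U = t ∧ Clq k E U ∧ (U ∩ {x}).Nonempty} : Finset (Finset (Fin n))) ≤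
        #𝒬 := by
      have hx : ∀ U : Finset (Fin n), (U ∩ {x}).Nonempty → x ∈ U := by
        rintro U ⟨y, hy⟩
        obtain ⟨hyU, hyx⟩ := mem_inter.1 hy
        exact mem_singleton.1 hyx ▸ hyU
      refine card_le_card_of_injOn (fun U => U.erase x) ?_ ?_
      · intro U hU
        obtain ⟨-, hUt, hUc, hUx⟩ := mem_filter.1 (mem_coe.1 hU)
        refine mem_coe.2 (mem_filter.2 ⟨mem_univ _, ?_, notMem_erase _ _, ?_⟩)
        · rw [card_erase_of_mem (hx U hUx), hUt]
        · rwa [insert_erase (hx U hUx)]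
      · intro U hU U' hU' h
        have h4 := hx U (mem_filter.1 (mem_coe.1 hU)).2.2.2
        have h5 := hx U' (mem_filter.1 (mem_coe.1 hU')).2.2.2
        rw [← insert_erase h4, ← insert_erase h5]
        exact congrArg (insert x) h
    refine le_trans (le_of_eq ?_) (h2.trans (Nat.cast_le.2 h3))
    rw [card_singleton, Nat.cast_one, one_mul, hc, ← mul_pow]
    congr 1
    ring
  have h2 : ∀ Q ∈ 𝒬, g * n ≤ #{y | y ∉ Q ∧ Clq k E (insert y Q)} := by
    intro Q hQ
    obtain ⟨-, hQc, hxQ, hQx⟩ := mem_filter.1 hQ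
    obtain ⟨X, hX, hv⟩ := hE.exists_clique_extension Q ∅ (hQx.mono (subset_insert _ _))
    have hsub : X ⊆ univ.filter fun y => y ∉ Q ∧ Clq k E (insert y Q) := fun v hvX =>
      mem_filter.2 ⟨mem_univ _, (hv v hvX).1, (hv v hvX).2.2⟩
    refine le_trans ?_ (Nat.cast_le.2 (card_le_card hsub))
    refine le_trans ?_ hX
    have hch : (1 : ℝ) ≤ (t - 1).choose (k - 1) := by
      exact_mod_cast Nat.choose_pos (by omega)
    have h3 := one_sub_choose_mul_ge hβγ hch le_rfl hβ hγ
    have h4 : ((t - 1 : ℕ) : ℝ) ≤ t := by exact_mod_cast Nat.sub_le t 1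
    have h5 := mul_le_mul_of_nonneg_right h3 hn0.le
    rw [hQc, card_empty]
    push_cast at h5 ⊢
    linarith
  have h3 : (#𝒬 : ℝ) * (g * n) ≤ ∑ y, (#(linkSets E (cliqueEdges t k) 1 x y) : ℝ) := by
    have h4 := sum_card_bipartiteAbove_eq_sum_card_bipartiteBelow (s := 𝒬)
      (t := (univ : Finset (Fin n))) (fun Q y => y ∉ Q ∧ Clq k E (insert y Q))
    have h5 : (#𝒬 : ℝ) * (g * n) ≤ ∑ Q ∈ 𝒬,
        (#(bipartiteAbove (fun Q y => y ∉ Q ∧ Clq k E (insert y Q)) univ Q) : ℝ) := by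
      rw [← nsmul_eq_mul]
      exact card_nsmul_le_sum _ _ _ h2
    refine h5.trans ?_
    have h6 : ∑ y, #(bipartiteBelow (fun Q y => y ∉ Q ∧ Clq k E (insert y Q)) 𝒬 y) ≤
        ∑ y, #(linkSets E (cliqueEdges t k) 1 x y) := by
      refine sum_le_sum fun y _ => card_le_card fun Q hQ => ?_
      obtain ⟨hQ, hyQ, hQy⟩ := mem_filter.1 hQ
      obtain ⟨-, hQc, hxQ, hQx⟩ := mem_filter.1 hQ
      exact Clq.mem_linkSets_one hQc (by omega) hxQ hyQ hQx hQy
    rw [← h4] at h6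
    exact_mod_cast h6
  have h4 := sum_le_card_filter_mul_add (univ : Finset (Fin n))
    (fun y => (#(linkSets E (cliqueEdges t k) 1 x y) : ℝ)) (M := (n : ℝ) ^ (t - 1))
    (η := c * g / 2 * (n : ℝ) ^ (t - 1)) (by positivity) (fun y _ => by
      have := card_linkSets_le (E := E) (EF := cliqueEdges t k) 1 x y
      rw [Fintype.card_fin, one_mul] at this
      exact_mod_cast this)
  simp only [closeTo_iff, Fintype.card_fin, one_mul]
  rw [card_univ, Fintype.card_fin] at h4
  have h5 : (0 : ℝ) < (n : ℝ) ^ (t - 1) := by positivity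
  have h6 : c * (n : ℝ) ^ (t - 1) * (g * n) ≤ #𝒬 * (g * n) := by gcongr
  refine le_of_mul_le_mul_right ?_ h5
  linarith

end BaseCase

lemma GoodL.mul_betaL_le {k t l : ℕ} (hk : 1 ≤ k) (hkt : k < t) (h : GoodL k t l) :
    ((t.choose (k - 1) : ℝ) + ((t - l - 1).choose (k - 1) : ℝ) +
      ((l + 1).choose (k - 1) : ℝ)) * betaL k t l = 2 ∧
    ((t - 1).choose (k - 1) + l.choose (k - 1) : ℝ) * betaL k t l ≤ 1 ∧
    ((2 * l + 1).choose (k - 1) : ℝ) * betaL k t l ≤ 1 / 2 := by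
  have h1 : (0 : ℝ) < t.choose (k - 1) := by exact_mod_cast Nat.choose_pos (by omega)
  have h2 : (0 : ℝ) < (t - 1).choose (k - 1) := by exact_mod_cast Nat.choose_pos (by omega)
  refine ⟨?_, ?_, ?_⟩
  · rw [betaL, mul_div_cancel₀]
    positivity
  · rw [mul_comm, ← le_div_iff₀ (by positivity)]
    exact h.2.1
  · rcases Nat.eq_zero_or_pos ((2 * l + 1).choose (k - 1)) with h0 | h0
    · rw [h0]; norm_num
    · have h3 : (0 : ℝ) < (2 * l + 1).choose (k - 1) := by exact_mod_cast h0
      have := h.2.2 h0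
      rw [le_div_iff₀ (by positivity)] at this
      linarith

lemma goodL_three_one {t : ℕ} (ht : 5 ≤ t) : GoodL 3 t 1 := by
  obtain ⟨s, rfl⟩ := Nat.exists_eq_add_of_le' ht
  have h1 : ∀ m : ℕ, ((m + 1).choose 2 : ℝ) = m.choose 2 + m := by
    intro m
    rw [Nat.choose_succ_succ' m 1, Nat.choose_one_right]
    push_cast
    ring
  have h2 : (6 : ℝ) ≤ (s + 4).choose 2 := by
    exact_mod_cast (Nat.choose_le_choose 2 (show 4 ≤ s + 4 by omega) : Nat.choose 4 2 ≤ _)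
  have h3 := h1 (s + 4)
  have h4 := h1 (s + 3)
  have hβ : betaL 3 (s + 5) 1 = 1 / ((s + 4).choose 2 + 1) := by
    rw [betaL, show s + 5 - 1 - 1 = s + 3 by omega, show 3 - 1 = 2 from rfl,
      show Nat.choose (1 + 1) 2 = 1 from rfl, div_eq_div_iff (by positivity) (by positivity)]
    push_cast at h3 h4 ⊢
    linarith
  refine ⟨by omega, ?_, fun _ => ?_⟩
  · rw [hβ, show s + 5 - 1 = s + 4 by omega, show Nat.choose 1 (3 - 1) = 0 from rfl,
      show 3 - 1 = 2 from rfl]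
    exact one_div_le_one_div_of_le (by push_cast; linarith) (by push_cast; linarith)
  · rw [hβ, show Nat.choose (2 * 1 + 1) (3 - 1) = 3 from rfl]
    exact one_div_le_one_div_of_le (by norm_num) (by push_cast; linarith)

lemma goodL_zero {k t : ℕ} (hk : 3 ≤ k) (hkt : k < t) : GoodL k t 0 := by
  have h1 : Nat.choose 1 (k - 1) = 0 := Nat.choose_eq_zero_of_lt (by omega)
  have h0 : Nat.choose 0 (k - 1) = 0 := Nat.choose_eq_zero_of_lt (by omega)
  have h2 : (0 : ℝ) < (t - 1).choose (k - 1) := by exact_mod_cast Nat.choose_pos (by omega)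
  have h3 : ((t - 1).choose (k - 1) : ℝ) ≤ t.choose (k - 1) := by
    exact_mod_cast Nat.choose_le_choose _ (Nat.sub_le t 1)
  refine ⟨by omega, ?_, fun h => ?_⟩
  · rw [betaL, zero_add, h1, h0, Nat.sub_zero, div_le_div_iff₀ (by positivity) (by positivity)]
    push_cast
    linarith
  · simp [h1] at h

lemma goodL_l0 {k t : ℕ} (hk : 3 ≤ k) (hkt : k < t) (h : 3 < k ∨ 4 < t) : GoodL k t (l0 k t) := by
  unfold l0
  split_ifs with h3
  · subst h3
    exact goodL_three_one (by omega)
  · exact Nat.sSup_mem (s := {l | GoodL k t l}) ⟨0, goodL_zero hk hkt⟩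
      ⟨t, fun l hl => by have := hl.1; omega⟩

lemma betaKT_three_four : betaKT 3 4 = 1 / 4 := by
  rw [betaKT, l0, if_pos rfl, betaL]
  norm_num [Nat.choose]

lemma choose_mul_betaKT_le {k t : ℕ} (hk : 3 ≤ k) (hkt : k < t) :
    ((t - 1).choose (k - 1) : ℝ) * betaKT k t ≤ 1 := by
  by_cases h : 3 < k ∨ 4 < t
  · have hg := goodL_l0 hk hkt h
    have h1 := (hg.mul_betaL_le (by omega) hkt).2.1
    have h2 : 0 ≤ betaL k t (l0 k t) := by unfold betaL; positivity
    refine le_trans ?_ h1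
    rw [betaKT]
    gcongr
    simp
  · obtain ⟨rfl, rfl⟩ : k = 3 ∧ t = 4 := by omega
    rw [betaKT_three_four]
    norm_num [Nat.choose]

/-- Every cut into two linear-sized parts is crossed by a positive proportion of all sets. -/
lemma exists_card_crossing_ge {k t : ℕ} (hk : 3 ≤ k) (hkt : k < t) {γ ε : ℝ} (hγ : 0 < γ)
    (hγβ : γ < betaKT k t) (hε : 0 < ε) :
    ∃ κ : ℝ, 0 < κ ∧ ∃ n₀ : ℕ, ∀ n : ℕ, n₀ ≤ n → ∀ E : Finset (Finset (Fin n)),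
      FewMissed k (betaKT k t - γ) E → ∀ A : Finset (Fin n), ε * n ≤ #A → (#A : ℝ) ≤ n / 2 →
      κ * (n : ℝ) ^ (t + 1) ≤ #(crossing k t E A) := by
  have hsize : ∀ g : ℝ, 0 < g → ∀ n : ℕ, ⌈t / g⌉₊ ≤ n → (t : ℝ) ≤ g * n := by
    intro g hg n hn
    rw [mul_comm, ← div_le_iff₀ hg]
    exact Nat.ceil_le.1 hn
  have hch : (2 : ℝ) ≤ (t - 1).choose (k - 1) := by
    have h1 : (t - 1).choose (k - 1) ≠ 0 := (Nat.choose_pos (by omega)).ne'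
    have h2 : k ≤ (t - 1).choose (k - 1) := by
      calc k = k.choose (k - 1) := by
            rw [← Nat.choose_symm (by omega : k - 1 ≤ k), show k - (k - 1) = 1 by omega,
              Nat.choose_one_right]
        _ ≤ _ := Nat.choose_le_choose _ (by omega)
    exact_mod_cast (show 2 ≤ (t - 1).choose (k - 1) by omega)
  have hβ1 := choose_mul_betaKT_le hk hkt
  have hγ2 : γ ≤ 1 / 2 := by nlinarith
  by_cases h : 3 < k ∨ 4 < t
  · have hgood := goodL_l0 hk hkt h
    obtain ⟨h1, h2, h3⟩ := hgood.mul_betaL_le (by omega) hkt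
    set D : ℝ := γ / 4 / 2 ^ (t + 1) with hD
    have hD0 : 0 < D := by positivity
    refine ⟨min (ε * D ^ t) (D ^ (t + 1)), by positivity, ⌈t / (γ / 4)⌉₊,
      fun n hn E hE A hA hA2 => ?_⟩
    have hDn : γ / 4 * n / 2 ^ (t + 1) = D * n := by rw [hD]; ring
    rcases hE.card_crossing_ge (by omega) hkt hgood.1 hγ hγβ hγ2 h2 h3 h1 (by positivity) le_rfl
      (hsize _ (by positivity) n hn) A hA2 with h4 | h4
    · refine le_trans ?_ h4
      rw [hDn]
      calc min (ε * D ^ t) (D ^ (t + 1)) * (n : ℝ) ^ (t + 1)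
          ≤ (ε * D ^ t) * (n : ℝ) ^ (t + 1) := by gcongr; exact min_le_left _ _
        _ = (ε * n) * (D * n) ^ t := by ring
        _ ≤ #A * (D * n) ^ t := by gcongr
    · refine le_trans ?_ h4
      rw [hDn, mul_pow]
      gcongr
      exact min_le_right _ _
  · obtain ⟨rfl, rfl⟩ : k = 3 ∧ t = 4 := by omega
    rw [betaKT_three_four] at hγβ ⊢
    set g : ℝ := min (γ / 4) (ε / 2) with hg
    have hg0 : 0 < g := by positivity
    refine ⟨ε * (g / 2 ^ 5) ^ 4 / (1 + 2 ^ 5 / g), by positivity, ⌈(4 : ℕ) / g⌉₊,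
      fun n hn E hE A hA hA2 => ?_⟩
    have hgε : g * n ≤ ε / 2 * n := by gcongr; exact min_le_right _ _
    have h4 := hE.card_crossing_ge_three_four hγ hγβ hg0 (min_le_left _ _)
      (by exact_mod_cast hsize g hg0 n hn) A hA2 (by linarith)
    rw [div_mul_eq_mul_div, div_le_iff₀ (by positivity)]
    refine le_trans ?_ h4
    calc ε * (g / 2 ^ 5) ^ 4 * (n : ℝ) ^ (4 + 1) = (ε * n) * (g * n / 2 ^ 5) ^ 4 := by ring
      _ ≤ #A * (g * n / 2 ^ 5) ^ 4 := by gcongr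

/-- A lower bound on all codegrees bounds the number of missed vertices. -/
lemma fewMissed_of_le_degOn {n k : ℕ} (hk : 1 ≤ k) {θ : ℝ} {E : Finset (Finset (Fin n))}
    (h : ∀ T : Finset (Fin n), #T = k - 1 → (1 - θ) * n ≤ (degOn E k T : ℝ)) :
    FewMissed k θ E := by
  intro T hT
  have h1 : degOn E k T ≤ #{v | insert v T ∈ E} := by
    rw [degOn, ← Set.ncard_coe_finset {v | insert v T ∈ E}]
    refine (Set.ncard_le_ncard (t := Set.image (fun v => ({v} : Finset (Fin n)))
      (({v | insert v T ∈ E} : Finset (Fin n)) : Set (Fin n))) ?_ (Set.toFinite _)).trans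
      (Set.ncard_image_le (Set.toFinite _))
    rintro S ⟨hS, -, hST⟩
    obtain ⟨v, rfl⟩ := card_eq_one.1 (show #S = 1 by omega)
    exact ⟨v, mem_coe.2 (mem_filter.2 ⟨mem_univ _, by rwa [insert_eq]⟩), rfl⟩
  have h2 : #{v | insert v T ∈ E} + #(missed E T) = n := by
    have := card_filter_add_card_filter_not (s := (univ : Finset (Fin n)))
      (fun v => insert v T ∈ E)
    rwa [card_univ, Fintype.card_fin] at this
  have h3 : (#{v | insert v T ∈ E} : ℝ) + #(missed E T) = n := by exact_mod_cast h2
  have h4 : (degOn E k T : ℝ) ≤ #{v | insert v T ∈ E} := by exact_mod_cast h1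
  have h5 := h T hT
  linarith

lemma exists_expands {k t : ℕ} (hk : 3 ≤ k) (hkt : k < t) {γ : ℝ} (hγ : 0 < γ)
    (hγβ : γ < betaKT k t) :
    ∃ κ ε η δ : ℝ, 0 < κ ∧ 0 < ε ∧ ε ≤ 1 / 4 ∧ 0 < η ∧ 0 < δ ∧ ∃ n₀ : ℕ, ∀ n : ℕ, n₀ ≤ n →
      ∀ E : Finset (Finset (Fin n)), FewMissed k (betaKT k t - γ) E →
      Expands E (cliqueEdges t k) κ ε η δ := by
  set c : ℝ := (γ / 4 / 2 ^ (t + 1)) ^ (t - 1) with hc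
  have hc0 : 0 < c := by positivity
  set η₀ : ℝ := c * (γ / 4) / 2 with hη₀
  have hη₀0 : 0 < η₀ := by positivity
  set ε : ℝ := min (1 / 4) η₀ with hε
  have hε0 : 0 < ε := by positivity
  obtain ⟨κ₀, hκ₀, n₀, hcut⟩ := exists_card_crossing_ge hk hkt hγ hγβ hε0
  set κ : ℝ := min κ₀ (4 * η₀) with hκ
  have hκ0 : 0 < κ := by positivity
  have hβ := choose_mul_betaKT_le hk hkt
  refine ⟨c, ε, κ / 4, κ / 4, hc0, hε0, min_le_left _ _, by positivity, by positivity,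
    n₀ + ⌈t / (γ / 4)⌉₊, fun n hn E hE => ⟨?_, fun x => ?_, fun A hA1 hA2 => ?_⟩⟩
  all_goals
    have hnt : (t : ℝ) ≤ γ / 4 * n := by
      rw [mul_comm, ← div_le_iff₀ (by positivity)]
      exact Nat.ceil_le.1 (by omega)
  · have h1 := hE.card_cliques_meeting (by omega) hkt hγ hγβ hβ (by positivity) le_rfl hnt univ
    rw [Fintype.card_fin]
    have hsub : univ.filter (fun U : Finset (Fin n) => #U = t ∧ Clq k E U ∧ (U ∩ univ).Nonempty) ⊆
        univ.filter fun K => IsCopy E (cliqueEdges t k) K := by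
      intro U hU
      obtain ⟨-, hUt, hUc, -⟩ := mem_filter.1 hU
      exact mem_filter.2 ⟨mem_univ _, hUc.isCopy hUt⟩
    refine le_trans (le_of_eq ?_) (h1.trans (Nat.cast_le.2 (card_le_card hsub)))
    rw [card_univ, Fintype.card_fin, hc, mul_div_right_comm, mul_pow]
    have : (n : ℝ) ^ t = n * (n : ℝ) ^ (t - 1) := by
      rw [← pow_succ', Nat.sub_add_cancel (by omega)]
    rw [this]
    ring
  · have h1 := hE.card_closeTo_one_ge (by omega) hkt hγ hγβ hβ (by positivity) le_rfl hnt x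
    have hsub : univ.filter (fun y => CloseTo E (cliqueEdges t k) 1 η₀ x y) ⊆
        univ.filter fun y => CloseTo E (cliqueEdges t k) 1 (κ / 4) x y := by
      intro y hy
      refine mem_filter.2 ⟨mem_univ _, (mem_filter.1 hy).2.mono ?_⟩
      have : κ ≤ 4 * η₀ := min_le_right _ _
      linarith
    refine le_trans ?_ (h1.trans (Nat.cast_le.2 (card_le_card hsub)))
    gcongr
    exact min_le_right _ _
  · refine card_filter_closeTo_ge (by omega) hκ0.le A ?_
    have hκκ : κ * (n : ℝ) ^ (t + 1) ≤ κ₀ * (n : ℝ) ^ (t + 1) := by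
      gcongr
      exact min_le_left _ _
    refine hκκ.trans ?_
    rcases le_total (#A : ℝ) (n / 2) with h | h
    · exact hcut n (by omega) E hE A hA1 h
    · rw [← crossing_compl]
      have h1 : (#(Aᶜ) : ℝ) = n - #A := by
        rw [card_compl, Fintype.card_fin, Nat.cast_sub]
        exact (card_le_univ A).trans_eq (Fintype.card_fin n)
      exact hcut n (by omega) E hE Aᶜ (by linarith) (by linarith)

end

/-- A `k`-graph with minimum codegree at least `(1 - β(k,t) + γ) n` is
`(K_t^k, i, η)`-closed for some `i` and `η > 0`. -/
theorem Kt_closed (k t : ℕ) (hk : 3 ≤ k) (hkt : k < t) (γ : ℝ)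
    (hγ : 0 < γ) (hγβ : γ < betaKT k t) :
    ∃ i : ℕ, 1 ≤ i ∧ ∃ η : ℝ, 0 < η ∧ ∃ n₀ : ℕ, ∀ n : ℕ, n₀ ≤ n →
      ∀ E : Finset (Finset (Fin n)), (∀ e ∈ E, e.card = k) →
      (∀ T : Finset (Fin n), T.card = k - 1 →
        (1 - betaKT k t + γ) * n ≤ (degOn E k T : ℝ)) →
      IsClosedGraph E (cliqueEdges t k) i η := by
  obtain ⟨κ, ε, η, δ, hκ, hε0, hε, hη, hδ, n₁, h₁⟩ := exists_expands hk hkt hγ hγβ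
  obtain ⟨i, hi, η', hη', n₂, h₂⟩ := Expands.exists_isClosedGraph (cliqueEdges t k)
    (by rw [Fintype.card_fin]; omega) hκ hη hδ hε0.le hε
  refine ⟨i, hi, η', hη', n₁ + n₂, fun n hn E _ hdeg => ?_⟩
  refine h₂ n (by omega) E (h₁ n (by omega) E (fewMissed_of_le_degOn (by omega) fun T hT => ?_))
  rw [sub_sub_eq_add_sub, add_sub_right_comm]
  exact hdeg T hT
end
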